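/- arXiv:1511.02935 — 2 statements merged into one kernel-verified Lean document; each statement's English description precedes it below -/
import Mathlib

section
/- Shelah's presentation theorem, including the extension property: if K is an AEC in a vocabulary τ with |τ| ≤ LS(K), then there are a vocabulary τ1 ⊇ τ of cardinality LS(K), a first-order τ1-theory T1, and a set Γ of at most 2^{LS(K)} partial types over the empty set such that: (1) K = {M'↾τ : M' ⊨ T1 and M' omits every type in Γ}; (2) if M' ⊆ N' are both models of T1 omitting Γ, then M'↾τ ≺_K N'↾τ; and (3) if M ≺_K N in K and M' ∈ EC(T1,Γ) satisfies M'↾τ = M, then there is N' ∈ EC(T1,Γ) with M' ⊆ N' and N'↾τ = N. -/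
universe u

open FirstOrder Cardinal

namespace Paper

/-- A bundled structure for the vocabulary (language) `L`. -/
abbrev Struct (L : FirstOrder.Language.{u, u}) : Type (u + 1) :=
  CategoryTheory.Bundled.{u} L.Structure

instance {L : FirstOrder.Language.{u, u}} (M : Struct L) : L.Structure M := M.str

/-- An abstract elementary class in the vocabulary `L`, presented via the class of its
strong (`≺_K`) embeddings: `Strong f` says that `f` is an isomorphism onto a
`≺_K`-substructure of its codomain.  The axioms are the usual AEC axioms:
closure under isomorphism, `≺_K` refines substructure (strong maps are `L`-embeddings),
reflexivity and transitivity (partial order), coherence, closure under unions of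
`≺_K`-increasing (directed) chains with the union `≺_K`-least among upper bounds,
and the existence of a Löwenheim–Skolem number `ls` (with `ℵ₀ + |τ| ≤ ls`). -/
structure AEC (L : FirstOrder.Language.{u, u}) : Type (u + 1) where
  Mem : Struct L → Prop
  Strong : ∀ {M N : Struct L}, (M ↪[L] N) → Prop
  ls : Cardinal.{u}
  aleph0_le_ls : ℵ₀ ≤ ls
  card_le_ls : L.card ≤ ls
  strong_dom : ∀ {M N : Struct L} (f : M ↪[L] N), Strong f → Mem M ∧ Mem N
  mem_iso : ∀ {M N : Struct L}, (M ≃[L] N) → Mem M → Mem N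
  strong_refl : ∀ {M : Struct L}, Mem M → Strong (FirstOrder.Language.Embedding.refl L M)
  strong_comp : ∀ {M N P : Struct L} (f : M ↪[L] N) (g : N ↪[L] P),
    Strong f → Strong g → Strong (g.comp f)
  strong_iso_comp : ∀ {M N P : Struct L} (f : M ≃[L] N) (g : N ↪[L] P),
    Mem M → Strong g → Strong (g.comp f.toEmbedding)
  coherence : ∀ {M N P : Struct L} (f : M ↪[L] N) (g : N ↪[L] P),
    Strong g → Strong (g.comp f) → Strong f
  chain_union : ∀ (I : Type u) [Preorder I], IsDirected I (· ≤ ·) → Nonempty I →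
    ∀ (M : I → Struct L) (f : ∀ i j, i ≤ j → (M i ↪[L] M j)),
      (∀ i, Mem (M i)) →
      (∀ i j (h : i ≤ j), Strong (f i j h)) →
      (∀ i j k (hij : i ≤ j) (hjk : j ≤ k),
        (f j k hjk).comp (f i j hij) = f i k (le_trans hij hjk)) →
      ∃ (P : Struct L) (g : ∀ i, M i ↪[L] P),
        Mem P ∧ (∀ i, Strong (g i)) ∧
        (∀ i j (hij : i ≤ j), (g j).comp (f i j hij) = g i) ∧
        (∀ x : P, ∃ (i : I) (y : M i), g i y = x) ∧
        ∀ (N : Struct L) (h : ∀ i, M i ↪[L] N),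
          Mem N → (∀ i, Strong (h i)) →
          (∀ i j (hij : i ≤ j), (h j).comp (f i j hij) = h i) →
          ∃ (t : P ↪[L] N), Strong t ∧ ∀ i, t.comp (g i) = h i
  loewenheim_skolem : ∀ (N : Struct L), Mem N → ∀ (A : Set N),
    ∃ (M : Struct L) (f : M ↪[L] N),
      Mem M ∧ Strong f ∧ A ⊆ Set.range f ∧ #M ≤ #A + ls

variable {L : FirstOrder.Language.{u, u}}

/-- The amalgamation property for models whose cardinality lies in the class `F`:
any triple `M0 ≺_K M1, M2` with all three models of size in `F` can be amalgamated. -/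
def AEC.AP (K : AEC L) (F : Set Cardinal.{u}) : Prop :=
  ∀ (M0 M1 M2 : Struct L) (e1 : M0 ↪[L] M1) (e2 : M0 ↪[L] M2),
    K.Mem M0 → K.Mem M1 → K.Mem M2 →
    #M0 ∈ F → #M1 ∈ F → #M2 ∈ F →
    K.Strong e1 → K.Strong e2 →
    ∃ (N : Struct L) (f1 : M1 ↪[L] N) (f2 : M2 ↪[L] N),
      K.Mem N ∧ K.Strong f1 ∧ K.Strong f2 ∧ f1.comp e1 = f2.comp e2

/-- The disjoint amalgamation property: the amalgamating embeddings can moreover be chosen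
with ranges intersecting exactly in the image of the base `M0`. -/
def AEC.DAP (K : AEC L) (F : Set Cardinal.{u}) : Prop :=
  ∀ (M0 M1 M2 : Struct L) (e1 : M0 ↪[L] M1) (e2 : M0 ↪[L] M2),
    K.Mem M0 → K.Mem M1 → K.Mem M2 →
    #M0 ∈ F → #M1 ∈ F → #M2 ∈ F →
    K.Strong e1 → K.Strong e2 →
    ∃ (N : Struct L) (f1 : M1 ↪[L] N) (f2 : M2 ↪[L] N),
      K.Mem N ∧ K.Strong f1 ∧ K.Strong f2 ∧ f1.comp e1 = f2.comp e2 ∧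
      Set.range ⇑f1 ∩ Set.range ⇑f2 = Set.range (⇑f1 ∘ ⇑e1)

/-- The joint embedding property for models whose cardinality lies in the class `F`. -/
def AEC.JEP (K : AEC L) (F : Set Cardinal.{u}) : Prop :=
  ∀ (M1 M2 : Struct L), K.Mem M1 → K.Mem M2 → #M1 ∈ F → #M2 ∈ F →
    ∃ (N : Struct L) (f1 : M1 ↪[L] N) (f2 : M2 ↪[L] N),
      K.Mem N ∧ K.Strong f1 ∧ K.Strong f2

/-- The disjoint joint embedding property: the embeddings have disjoint ranges. -/
def AEC.DJEP (K : AEC L) (F : Set Cardinal.{u}) : Prop :=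
  ∀ (M1 M2 : Struct L), K.Mem M1 → K.Mem M2 → #M1 ∈ F → #M2 ∈ F →
    ∃ (N : Struct L) (f1 : M1 ↪[L] N) (f2 : M2 ↪[L] N),
      K.Mem N ∧ K.Strong f1 ∧ K.Strong f2 ∧ Disjoint (Set.range ⇑f1) (Set.range ⇑f2)

end Paper
namespace Paper

open FirstOrder.Language

/-- With respect to the `L1`-structure `S` on `M`, the structure `M` models the first-order
theory `T1` and omits every partial type (over the empty set, in finitely many variables)
in the set `Γ`. -/
def ModelsOmitting (L1 : FirstOrder.Language.{u, u}) (T1 : L1.Theory)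
    (Γ : Set (Σ n : ℕ, Set (L1.Formula (Fin n)))) (M : Type u) [L1.Structure M] : Prop :=
  (∀ ψ ∈ T1, M ⊨ ψ) ∧ ∀ p ∈ Γ, ∀ v : Fin p.1 → M, ∃ φ ∈ p.2, ¬ φ.Realize v

/-- An `L1`-embedding is in particular an `L`-embedding of the reducts along `ϕ : L →ᴸ L1`. -/
def reductEmb {L L1 : FirstOrder.Language.{u, u}} (ϕ : L →ᴸ L1) {M N : Type u}
    [SM : L1.Structure M] [SN : L1.Structure N] (f : M ↪[L1] N) :
    @FirstOrder.Language.Embedding L M N (ϕ.reduct M) (ϕ.reduct N) :=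
  letI := ϕ.reduct M
  letI := ϕ.reduct N
  { toEmbedding := f.toEmbedding
    map_fun' := fun {n} g x => f.map_fun (ϕ.onFunction g) x
    map_rel' := fun {n} r x => f.map_rel (ϕ.onRelation r) x }

end Paper

namespace Paper

open FirstOrder.Language

section Presentation

open Structure

variable {L : FirstOrder.Language.{u, u}}

/-- An embedding whose range is contained in the range of another one factors through it. -/
lemma exists_comp_eq {P Q M : Struct L} (p : P ↪[L] M) (q : Q ↪[L] M)
    (h : Set.range p ⊆ Set.range q) : ∃ f : P ↪[L] Q, q.comp f = p := by
  choose f hf using fun x => h ⟨x, rfl⟩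
  refine ⟨⟨⟨f, fun x y hxy => p.injective ?_⟩, fun F x => q.injective ?_, fun R x => ?_⟩, ?_⟩
  · rw [← hf x, ← hf y, hxy]
  · change q (f _) = q (funMap F (f ∘ x))
    rw [hf, p.map_fun, q.map_fun, ← Function.comp_assoc]
    congr 1
    exact funext fun i => (hf _).symm
  · change RelMap R (f ∘ x) ↔ _
    rw [← p.map_rel, ← q.map_rel, ← Function.comp_assoc]
    have : ⇑q ∘ f = p := funext hf
    rw [this]
  · ext x
    exact hf x

/-- A surjective embedding, as an isomorphism. -/
noncomputable def equivOfSurjective {P Q : Struct L} (f : P ↪[L] Q) (h : Function.Surjective f) :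
    P ≃[L] Q :=
  ⟨Equiv.ofBijective f ⟨f.injective, h⟩, f.map_fun', f.map_rel'⟩

/-- Embeddings with the same range have isomorphic domains. -/
lemma exists_equiv_of_range_eq {P Q M : Struct L} (p : P ↪[L] M) (q : Q ↪[L] M)
    (h : Set.range p = Set.range q) : ∃ e : P ≃[L] Q, ∀ x, q (e x) = p x := by
  obtain ⟨f, hf⟩ := exists_comp_eq p q h.subset
  have hf' : ∀ x, q (f x) = p x := fun x => DFunLike.congr_fun hf x
  refine ⟨equivOfSurjective f fun y => ?_, hf'⟩
  obtain ⟨x, hx⟩ := h.symm.subset ⟨y, rfl⟩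
  exact ⟨x, q.injective ((hf' x).trans hx)⟩

namespace AEC

variable (K : AEC L)

lemma strong_equiv {M N : Struct L} (e : M ≃[L] N) (h : K.Mem M) : K.Strong e.toEmbedding :=
  K.strong_iso_comp e (Embedding.refl L N) h (K.strong_refl (K.mem_iso e h))

/-- `A ≺_K B`, for subsets `A` and `B` of an `L`-structure `M`. -/
def StrongSub (M : Struct L) (A B : Set M) : Prop :=
  ∃ (P Q : Struct L) (f : P ↪[L] Q) (q : Q ↪[L] M),
    K.Strong f ∧ Set.range (q ∘ f) = A ∧ Set.range q = B

variable {K}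

lemma StrongSub.subset {M : Struct L} {A B : Set M} (h : K.StrongSub M A B) : A ⊆ B := by
  obtain ⟨P, Q, f, q, -, rfl, rfl⟩ := h
  exact Set.range_comp_subset_range _ _

lemma StrongSub.strong {M P Q : Struct L} {A B : Set M} (h : K.StrongSub M A B)
    (f : P ↪[L] Q) (q : Q ↪[L] M) (hA : Set.range (q ∘ f) = A) (hB : Set.range q = B) :
    K.Strong f := by
  obtain ⟨P', Q', f', q', hf, rfl, rfl⟩ := h
  obtain ⟨a, ha⟩ := exists_equiv_of_range_eq (q.comp f) (q'.comp f') hA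
  obtain ⟨c, hc⟩ := exists_equiv_of_range_eq q' q hB.symm
  have hP := K.mem_iso a.symm (K.strong_dom f' hf).1
  have : f = c.toEmbedding.comp (f'.comp a.toEmbedding) := by
    ext x
    exact q.injective ((ha x).symm.trans (hc _).symm)
  rw [this]
  exact K.strong_comp _ _ (K.strong_comp _ _ (K.strong_equiv a hP) hf)
    (K.strong_equiv c (K.strong_dom f' hf).2)

lemma Strong.strongSub {M P : Struct L} {p : P ↪[L] M} (h : K.Strong p) :
    K.StrongSub M (Set.range p) Set.univ :=
  ⟨P, M, p, Embedding.refl L M, h, rfl, Set.range_id⟩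

lemma StrongSub.exists_strong {M : Struct L} {A : Set M} (h : K.StrongSub M A Set.univ) :
    ∃ (P : Struct L) (p : P ↪[L] M), K.Strong p ∧ Set.range p = A := by
  have h' := h
  obtain ⟨P, Q, f, q, -, hA, hB⟩ := h'
  exact ⟨P, q.comp f, h.strong (q.comp f) (Embedding.refl L M) hA Set.range_id, hA⟩

lemma StrongSub.of_subset {M : Struct L} {A B : Set M} (hA : K.StrongSub M A Set.univ)
    (hB : K.StrongSub M B Set.univ) (hAB : A ⊆ B) : K.StrongSub M A B := by
  obtain ⟨P, p, hp, rfl⟩ := hA.exists_strong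
  obtain ⟨Q, q, hq, rfl⟩ := hB.exists_strong
  obtain ⟨f, rfl⟩ := exists_comp_eq p q hAB
  exact ⟨P, Q, f, q, K.coherence f q hq hp, rfl, rfl⟩

lemma StrongSub.image {M N : Struct L} {A : Set M} (hA : K.StrongSub M A Set.univ)
    {g : M ↪[L] N} (hg : K.Strong g) : K.StrongSub N (g '' A) Set.univ := by
  obtain ⟨P, p, hp, rfl⟩ := hA.exists_strong
  rw [← Set.range_comp]
  exact Strong.strongSub (K.strong_comp p g hp hg)

/-- Closure under directed unions, and minimality of the union, in terms of subsets. -/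
lemma directed_union {ι : Type u} [Preorder ι] [IsDirected ι (· ≤ ·)] [Nonempty ι]
    {M : Struct L} {A : ι → Set M} (hA : ∀ i j, i ≤ j → K.StrongSub M (A i) (A j))
    (hM : ∀ x, ∃ i, x ∈ A i) :
    K.Mem M ∧ (∀ i, K.StrongSub M (A i) Set.univ) ∧
      ∀ (N : Struct L) (g : M ↪[L] N), (∀ i, K.StrongSub N (g '' A i) Set.univ) → K.Strong g := by
  have hex : ∀ i, ∃ (Q : Struct L) (q : Q ↪[L] M), Set.range q = A i := fun i => by
    obtain ⟨-, Q, -, q, -, -, h⟩ := hA i i le_rfl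
    exact ⟨Q, q, h⟩
  choose Q q hq using hex
  have hfac : ∀ i j, i ≤ j → ∃ f : Q i ↪[L] Q j, (q j).comp f = q i := fun i j hij =>
    exists_comp_eq _ _ (by rw [hq, hq]; exact (hA i j hij).subset)
  choose f hf using hfac
  have hf' : ∀ i j hij x, q j (f i j hij x) = q i x := fun i j hij x =>
    DFunLike.congr_fun (hf i j hij) x
  have hs : ∀ i j hij, K.Strong (f i j hij) := fun i j hij => by
    refine (hA i j hij).strong (f i j hij) (q j) ?_ (hq j)
    rw [← hq i, ← hf i j hij]
    rfl
  have hcomp : ∀ i j k (hij : i ≤ j) (hjk : j ≤ k),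
      (f j k hjk).comp (f i j hij) = f i k (hij.trans hjk) := fun i j k hij hjk => by
    ext x
    refine (q k).injective ?_
    rw [Embedding.comp_apply, hf', hf', hf']
  obtain ⟨P, g, hP, hg, hgf, hsurj, hleast⟩ := K.chain_union ι inferInstance inferInstance Q f
    (fun i => (K.strong_dom _ (hs i i le_rfl)).1) hs hcomp
  have : DirectedSystem (fun i => (Q i : Type u)) fun i j h => f i j h :=
    { map_self := fun i x => (q i).injective (hf' i i le_rfl x)
      map_map := fun _ _ _ hij hjk x => DFunLike.congr_fun (hcomp _ _ _ hij hjk) x }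
  let D : Struct L := ⟨Language.DirectLimit (fun i => (Q i : Type u)) f, inferInstance⟩
  let a : D ↪[L] P := Language.DirectLimit.lift L ι (fun i => (Q i : Type u)) f g
    fun i j hij x => DFunLike.congr_fun (hgf i j hij) x
  let b : D ↪[L] M := Language.DirectLimit.lift L ι (fun i => (Q i : Type u)) f q hf'
  have ha : ∀ i x, a (Language.DirectLimit.of L ι _ f i x) = g i x := fun i x =>
    Language.DirectLimit.lift_of _ _ _
  have hb : ∀ i x, b (Language.DirectLimit.of L ι _ f i x) = q i x := fun i x =>
    Language.DirectLimit.lift_of _ _ _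
  have ha_surj : Function.Surjective a := fun y => by
    obtain ⟨i, x, rfl⟩ := hsurj y
    exact ⟨_, ha i x⟩
  have hb_surj : Function.Surjective b := fun y => by
    obtain ⟨i, hi⟩ := hM y
    rw [← hq i] at hi
    obtain ⟨x, rfl⟩ := hi
    exact ⟨_, hb i x⟩
  let e : P ≃[L] M := (equivOfSurjective b hb_surj).comp (equivOfSurjective a ha_surj).symm
  have he : ∀ i x, e (g i x) = q i x := fun i x => by
    rw [← ha i x, ← hb i x]
    exact congrArg b ((equivOfSurjective a ha_surj).symm_apply_apply
      (Language.DirectLimit.of L ι (fun i => (Q i : Type u)) f i x))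
  have hMK : K.Mem M := K.mem_iso e hP
  have hqs : ∀ i, K.Strong (q i) := fun i => by
    have : q i = e.toEmbedding.comp (g i) := by
      ext x
      exact (he i x).symm
    rw [this]
    exact K.strong_comp _ _ (hg i) (K.strong_equiv e hP)
  refine ⟨hMK, fun i => hq i ▸ Strong.strongSub (hqs i), fun N j hj => ?_⟩
  have hjq : ∀ i, K.Strong (j.comp (q i)) := fun i => by
    refine (hj i).strong _ (Embedding.refl L N) ?_ Set.range_id
    rw [← hq i, ← Set.range_comp]
    rfl
  obtain ⟨i₀⟩ := ‹Nonempty ι›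
  obtain ⟨t, ht, htg⟩ := hleast N (fun i => j.comp (q i)) (K.strong_dom _ (hjq i₀)).2 hjq
    fun i k hik => by
      ext x
      exact congrArg j (hf' i k hik x)
  have : j = t.comp e.symm.toEmbedding := by
    ext y
    obtain ⟨i, hi⟩ := hM y
    rw [← hq i] at hi
    obtain ⟨x, rfl⟩ := hi
    have h1 : t (g i x) = j (q i x) := DFunLike.congr_fun (htg i) x
    have h2 : e.symm (q i x) = g i x := by rw [← he i x, e.symm_apply_apply]
    rw [← h1, ← h2]
    rfl
  rw [this]
  exact K.strong_comp _ _ (K.strong_equiv e.symm hMK) ht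

end AEC

/-- The vocabulary added to `L`: function symbols indexed by `I` in each positive arity, and one
nullary relation symbol, which records whether the empty structure is a strong submodel. -/
def presentationLang (I : Type u) : FirstOrder.Language.{u, u} where
  Functions n := {_i : I // n ≠ 0}
  Relations n := {_x : PUnit.{u + 1} // n = 0}

variable {I : Type u}

instance : IsEmpty ((presentationLang I).Functions 0) := ⟨fun i => i.2 rfl⟩

/-- An interpretation on `M` of the function symbols of `presentationLang I`. -/
abbrev Interp (I M : Type u) : Type u :=
  ∀ n, (presentationLang I).Functions n → (Fin n → M) → M

/-- The set of values at `a` of all the function symbols of `presentationLang I`. -/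
def hull {M : Type u} (F : Interp I M) {n : ℕ} (a : Fin n → M) : Set M :=
  Set.range fun i => F n i a

lemma hull_zero {M : Type u} (F : Interp I M) (a : Fin 0 → M) : hull F a = ∅ :=
  Set.range_eq_empty _

/-- The hulls of the finite tuples of `M` form a directed system of strong submodels
covering `M`. The empty tuple takes part in the system when `E` holds. -/
structure IsGood (K : AEC L) (M : Struct L) (F : Interp I M) (E : Prop) : Prop where
  mem_hull : ∀ n (a : Fin n → M) i, a i ∈ hull F a
  strong : ∀ m n (a : Fin m → M) (b : Fin n → M), (m ≠ 0 ∨ E) → Set.range a ⊆ Set.range b →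
    K.StrongSub M (hull F a) (hull F b)
  nonempty_or : Nonempty M ∨ E

lemma IsGood.directed_union {K : AEC L} {M : Struct L} {F : Interp I M} {E : Prop}
    (h : IsGood K M F E) :
    K.Mem M ∧ (∀ n (a : Fin n → M), (n ≠ 0 ∨ E) → K.StrongSub M (hull F a) Set.univ) ∧
      ∀ (N : Struct L) (g : M ↪[L] N),
        (∀ n (a : Fin n → M), (n ≠ 0 ∨ E) → K.StrongSub N (g '' hull F a) Set.univ) →
        K.Strong g := by
  let ι : Type u := {x : Σ n, Fin n → M // x.1 ≠ 0 ∨ E}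
  let _ : Preorder ι := Preorder.lift fun x => Set.range x.1.2
  have hdir : IsDirected ι (· ≤ ·) := by
    refine ⟨fun x y => ⟨⟨⟨_, Fin.append x.1.2 y.1.2⟩, ?_⟩, ?_, ?_⟩⟩
    · exact x.2.imp_left fun hx => by simp [hx]
    · rintro - ⟨i, rfl⟩
      exact ⟨Fin.castAdd _ i, Fin.append_left _ _ _⟩
    · rintro - ⟨i, rfl⟩
      exact ⟨Fin.natAdd _ i, Fin.append_right _ _ _⟩
  have hne : Nonempty ι := by
    rcases h.nonempty_or with ⟨⟨x⟩⟩ | hE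
    · exact ⟨⟨⟨1, fun _ => x⟩, Or.inl one_ne_zero⟩⟩
    · exact ⟨⟨⟨0, Fin.elim0⟩, Or.inr hE⟩⟩
  obtain ⟨h1, h2, h3⟩ := AEC.directed_union (K := K) (ι := ι) (A := fun x => hull F x.1.2)
    (fun x y hxy => h.strong _ _ _ _ x.2 hxy)
    (fun x => ⟨⟨⟨1, fun _ => x⟩, Or.inl one_ne_zero⟩, h.mem_hull 1 (fun _ => x) 0⟩)
  exact ⟨h1, fun n a hn => h2 ⟨⟨n, a⟩, hn⟩, fun N g hg => h3 N g fun x => hg _ x.1.2 x.2⟩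

/-- The hulls of the nonempty finite tuples from `D` form a monotone system of strong submodels
of `N`. -/
structure IsSystemOn (K : AEC L) (N : Struct L) (F : Interp I N) (D : Set N) : Prop where
  mem_hull : ∀ n (a : Fin n → N), Set.range a ⊆ D → ∀ i, a i ∈ hull F a
  mono : ∀ m n (a : Fin m → N) (b : Fin n → N), Set.range b ⊆ D → Set.range a ⊆ Set.range b →
    hull F a ⊆ hull F b
  strong : ∀ n (a : Fin n → N), n ≠ 0 → Set.range a ⊆ D → K.StrongSub N (hull F a) Set.univ

lemma IsSystemOn.isGood {K : AEC L} {N : Struct L} {F : Interp I N} {E : Prop}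
    (h : IsSystemOn K N F Set.univ) (hE : E → K.StrongSub N ∅ Set.univ)
    (hNE : Nonempty N ∨ E) : IsGood K N F E := by
  have hstrong : ∀ n (a : Fin n → N), (n ≠ 0 ∨ E) → K.StrongSub N (hull F a) Set.univ := by
    intro n a hn
    by_cases hn0 : n = 0
    · subst hn0
      rw [hull_zero]
      exact hE (hn.resolve_left (fun h => h rfl))
    · exact h.strong n a hn0 (Set.subset_univ _)
  refine ⟨fun n a => h.mem_hull n a (Set.subset_univ _), fun m n a b hm hab => ?_, hNE⟩
  refine (hstrong m a hm).of_subset (hstrong n b (hm.imp_left fun hm0 => ?_))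
    (h.mono _ _ _ _ (Set.subset_univ _) hab)
  rintro rfl
  obtain ⟨i, -⟩ := hab ⟨⟨0, Nat.pos_of_ne_zero hm0⟩, rfl⟩
  exact i.elim0

lemma exists_tuple_range_eq {N : Type u} (s : Finset N) :
    ∃ (n : ℕ) (a : Fin n → N), Set.range a = s :=
  ⟨s.card, fun i => s.equivFin.symm i, by
    rw [Set.range_comp' Subtype.val, s.equivFin.symm.surjective.range_eq]
    simp⟩

lemma AEC.exists_strongSub (K : AEC L) {N : Struct L} (hN : K.Mem N) (A : Set N)
    (hA : #A ≤ K.ls) : ∃ B : Set N, A ⊆ B ∧ K.StrongSub N B Set.univ ∧ #B ≤ K.ls := by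
  obtain ⟨M, f, -, hf, hAf, hM⟩ := K.loewenheim_skolem N hN A
  refine ⟨Set.range f, hAf, AEC.Strong.strongSub hf, mk_range_le.trans (hM.trans ?_)⟩
  exact add_le_of_le K.aleph0_le_ls hA le_rfl

/-- A partial assignment of small strong submodels to finite sets extends to a total one. -/
lemma AEC.exists_assignment (K : AEC L) {N : Struct L} (hN : K.Mem N) (D : Set N)
    (V : Finset N → Set N) (hcard : ∀ s : Finset N, ↑s ⊆ D → #(V s) ≤ K.ls)
    (hsub : ∀ s : Finset N, ↑s ⊆ D → ↑s ⊆ V s)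
    (hmono : ∀ s t : Finset N, ↑t ⊆ D → s ⊆ t → V s ⊆ V t)
    (hstrong : ∀ s : Finset N, s.Nonempty → ↑s ⊆ D → K.StrongSub N (V s) Set.univ) :
    ∃ W : Finset N → Set N, (∀ s : Finset N, ↑s ⊆ D → W s = V s) ∧
      (∀ s, #(W s) ≤ K.ls) ∧ (∀ s : Finset N, ↑s ⊆ W s) ∧ (∀ s t, s ⊆ t → W s ⊆ W t) ∧
      ∀ s : Finset N, s.Nonempty → K.StrongSub N (W s) Set.univ := by
  classical
  have hex : ∀ A : Set N, ∃ B : Set N,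
      #A ≤ K.ls → A ⊆ B ∧ K.StrongSub N B Set.univ ∧ #B ≤ K.ls := fun A => by
    by_cases hA : #A ≤ K.ls
    · obtain ⟨B, hB⟩ := K.exists_strongSub hN A hA
      exact ⟨B, fun _ => hB⟩
    · exact ⟨∅, fun h => absurd h hA⟩
  choose cl hcl using hex
  let base (s : Finset N) (W : ∀ t ⊂ s, Set N) : Set N := ↑s ∪ ⋃ t : {t // t ⊂ s}, W t.1 t.2
  let W : Finset N → Set N := Finset.strongInduction fun s ih =>
    if ↑s ⊆ D then V s else cl (base s ih)
  have hW : ∀ s, W s = if ↑s ⊆ D then V s else cl (base s fun t _ => W t) := fun s =>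
    Finset.strongInduction_eq _ s
  have hWD : ∀ s : Finset N, ↑s ⊆ D → W s = V s := fun s hs => by rw [hW, if_pos hs]
  have hWc : ∀ s, #(W s) ≤ K.ls ∧ (¬ ↑s ⊆ D → #(base s fun t _ => W t) ≤ K.ls) := by
    intro s
    induction s using Finset.strongInduction with
    | H s ih =>
      by_cases hs : ↑s ⊆ D
      · exact ⟨hWD s hs ▸ hcard s hs, fun h => absurd hs h⟩
      · have hfin : Finite {t // t ⊂ s} :=
          Finite.of_injective (β := {t // t ∈ s.powerset})
            (fun t => ⟨t.1, Finset.mem_powerset.2 t.2.1⟩)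
            fun t t' h => Subtype.ext (congrArg (fun x => x.1) h)
        have hb : #(base s fun t _ => W t) ≤ K.ls := by
          refine (mk_union_le _ _).trans (add_le_of_le K.aleph0_le_ls ?_ ?_)
          · exact (lt_aleph0_of_finite _).le.trans K.aleph0_le_ls
          · refine (mk_iUnion_le_sum_mk.trans (sum_le_sum _ (fun _ => K.ls)
              fun t : {t // t ⊂ s} => (ih t.1 t.2).1)).trans ?_
            rw [sum_const']
            exact mul_le_of_le K.aleph0_le_ls
              ((lt_aleph0_of_finite _).le.trans K.aleph0_le_ls) le_rfl
        refine ⟨?_, fun _ => hb⟩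
        rw [hW, if_neg hs]
        exact (hcl _ hb).2.2
  have hWcl : ∀ s : Finset N, ¬ ↑s ⊆ D →
      (base s fun t _ => W t) ⊆ W s ∧ K.StrongSub N (W s) Set.univ := fun s hs => by
    obtain ⟨h1, h2, -⟩ := hcl _ ((hWc s).2 hs)
    have := hW s
    rw [if_neg hs] at this
    rw [← this] at h1 h2
    exact ⟨h1, h2⟩
  refine ⟨W, hWD, fun s => (hWc s).1, fun s => ?_, fun s t hst => ?_, fun s hs => ?_⟩
  · by_cases hs : ↑s ⊆ D
    · exact hWD s hs ▸ hsub s hs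
    · exact Set.subset_union_left.trans (hWcl s hs).1
  · by_cases ht : ↑t ⊆ D
    · rw [hWD t ht, hWD s ((Finset.coe_subset.2 hst).trans ht)]
      exact hmono s t ht hst
    · rcases hst.eq_or_ssubset with rfl | hst
      · exact subset_rfl
      · exact ((Set.subset_iUnion (fun t' : {t' // t' ⊂ t} => W t'.1) ⟨s, hst⟩).trans
          Set.subset_union_right).trans (hWcl t ht).1
  · by_cases hsD : ↑s ⊆ D
    · exact hWD s hsD ▸ hstrong s hs hsD
    · exact (hWcl s hsD).2

/-- A system on a subset of `N` extends to a system on `N`. -/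
lemma IsSystemOn.exists_extension {K : AEC L} (hI : #I = K.ls) {N : Struct L} (hN : K.Mem N)
    {F : Interp I N} {D : Set N} (h : IsSystemOn K N F D) :
    ∃ F' : Interp I N, IsSystemOn K N F' Set.univ ∧
      ∀ n i (a : Fin n → N), Set.range a ⊆ D → F' n i a = F n i a := by
  classical
  let V (s : Finset N) : Set N := {x | ∃ n, ∃ a : Fin n → N, Set.range a = s ∧ x ∈ hull F a}
  have hV : ∀ n (a : Fin n → N) (s : Finset N), ↑s ⊆ D → Set.range a = s → V s = hull F a := by
    intro n a s hs ha
    refine Set.Subset.antisymm ?_ fun x hx => ⟨n, a, ha, hx⟩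
    rintro x ⟨m, b, hb, hx⟩
    exact h.mono _ _ _ _ (ha ▸ hs) (hb.trans ha.symm).subset hx
  obtain ⟨W, hWD, hWc, hWs, hWm, hWst⟩ := K.exists_assignment hN D V
    (fun s hs => by
      obtain ⟨n, a, ha⟩ := exists_tuple_range_eq s
      rw [hV n a s hs ha, ← hI]
      exact mk_range_le.trans (mk_subtype_le _))
    (fun s hs => by
      obtain ⟨n, a, ha⟩ := exists_tuple_range_eq s
      rw [hV n a s hs ha, ← ha]
      rintro - ⟨i, rfl⟩
      exact h.mem_hull n a (ha ▸ hs) i)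
    (fun s t ht hst => by
      obtain ⟨n, a, ha⟩ := exists_tuple_range_eq s
      obtain ⟨m, b, hb⟩ := exists_tuple_range_eq t
      have hst' := Finset.coe_subset.2 hst
      rw [hV n a s (hst'.trans ht) ha, hV m b t ht hb]
      exact h.mono _ _ _ _ (hb ▸ ht) (by rwa [ha, hb]))
    (fun s hs hsD => by
      obtain ⟨n, a, ha⟩ := exists_tuple_range_eq s
      rw [hV n a s hsD ha]
      refine h.strong n a ?_ (ha ▸ hsD)
      rintro rfl
      rw [Set.range_eq_empty, eq_comm, Finset.coe_eq_empty] at ha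
      exact hs.ne_empty ha)
  let r {n : ℕ} (a : Fin n → N) : Finset N := Finset.univ.image a
  have hr : ∀ {n : ℕ} (a : Fin n → N), (r a : Set N) = Set.range a := fun a => by simp [r]
  have hex : ∀ n (a : Fin n → N), ∃ e : (presentationLang I).Functions n → N,
      (n ≠ 0 → Set.range e = W (r a)) ∧ (Set.range a ⊆ D → ∀ i, e i = F n i a) := by
    intro n a
    by_cases ha : Set.range a ⊆ D
    · refine ⟨fun i => F n i a, fun _ => ?_, fun _ _ => rfl⟩
      rw [← hr] at ha
      rw [hWD _ ha, hV n a _ ha (hr a).symm]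
      rfl
    · have hn : n ≠ 0 := by
        rintro rfl
        exact ha (by rw [Set.range_eq_empty]; exact Set.empty_subset D)
      have : Nonempty (W (r a)) :=
        ⟨⟨a ⟨0, Nat.pos_of_ne_zero hn⟩, hWs (r a) (by rw [hr]; exact ⟨_, rfl⟩)⟩⟩
      have hle : #(W (r a)) ≤ #((presentationLang I).Functions n) := by
        refine (hWc _).trans (hI ▸ ?_)
        exact mk_le_of_injective (f := fun i => (⟨i, hn⟩ : {_i : I // n ≠ 0}))
          fun i j hij => congrArg (fun x => x.1) hij
      obtain ⟨φ⟩ := hle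
      refine ⟨fun i => (Function.invFun φ i : W (r a)), fun _ => ?_, fun h => absurd h ha⟩
      rw [Set.range_comp' Subtype.val, (Function.invFun_surjective φ.injective).range_eq]
      simp
  choose e he heD using hex
  have hhull : ∀ n (a : Fin n → N), n ≠ 0 → hull (fun n i a => e n a i) a = W (r a) :=
    fun n a hn => he n a hn
  refine ⟨fun n i a => e n a i, ⟨fun n a _ i => ?_, fun m n a b _ hab => ?_, fun n a hn _ => ?_⟩,
    fun n i a ha => heD n a ha i⟩
  · rw [hhull n a (by rintro rfl; exact i.elim0)]
    exact hWs _ ((hr a).symm ▸ ⟨i, rfl⟩)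
  · by_cases hm : m = 0
    · subst hm
      rw [hull_zero]
      exact Set.empty_subset _
    · have hn : n ≠ 0 := by
        rintro rfl
        obtain ⟨i, -⟩ := hab ⟨⟨0, Nat.pos_of_ne_zero hm⟩, rfl⟩
        exact i.elim0
      rw [hhull m a hm, hhull n b hn]
      exact hWm _ _ (by rwa [← Finset.coe_subset, hr, hr])
  · rw [hhull n a hn]
    refine hWst _ ?_
    rw [← Finset.coe_nonempty, hr]
    exact ⟨_, ⟨0, Nat.pos_of_ne_zero hn⟩, rfl⟩

/-- The `L`-reduct of an expanded structure. -/
def red {M : Type u} (S : (L.sum (presentationLang I)).Structure M) : Struct L :=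
  ⟨M, (LHom.sumInl : L →ᴸ L.sum (presentationLang I)).reduct M⟩

/-- The interpretation of the added function symbols. -/
def interp {M : Type u} (S : (L.sum (presentationLang I)).Structure M) : Interp I M :=
  fun _ i a => S.funMap (Sum.inr i) a

/-- The added nullary relation symbol. -/
def flagSymbol (L : FirstOrder.Language.{u, u}) (I : Type u) :
    (L.sum (presentationLang I)).Relations 0 :=
  Sum.inr ⟨⟨⟩, rfl⟩

/-- The truth value of the added nullary relation symbol. -/
def flag {M : Type u} (S : (L.sum (presentationLang I)).Structure M) : Prop :=
  S.RelMap (flagSymbol L I) default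

/-- The part of `IsGood` that concerns the subtuples of a given tuple. -/
def IsGoodAt (K : AEC L) {M : Type u} (S : (L.sum (presentationLang I)).Structure M) {n : ℕ}
    (b : Fin n → M) : Prop :=
  (∀ i, b i ∈ hull (interp S) b) ∧
    (∀ m (σ : Fin m → Fin n), (m ≠ 0 ∨ flag S) →
      K.StrongSub (red S) (hull (interp S) (b ∘ σ)) (hull (interp S) b)) ∧
    (Nonempty M ∨ flag S)

lemma isGood_iff {K : AEC L} {M : Type u} {S : (L.sum (presentationLang I)).Structure M} :
    IsGood K (red S) (interp S) (flag S) ↔ ∀ n (b : Fin n → M), IsGoodAt K S b := by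
  refine ⟨fun h n b => ⟨h.mem_hull n b, fun m σ hm => h.strong m n _ b hm
    (Set.range_comp_subset_range _ _), h.nonempty_or⟩, fun h => ⟨fun n b => (h n b).1,
    fun m n a b hm hab => ?_, (h 0 Fin.elim0).2.2⟩⟩
  choose σ hσ using fun i => hab ⟨i, rfl⟩
  obtain rfl : b ∘ σ = a := funext hσ
  exact (h n b).2.1 m σ hm

/-- The term for the value of an added function symbol at a subtuple. -/
def hullTerm (L : FirstOrder.Language.{u, u}) {m n : ℕ} (σ : Fin m → Fin n)
    (i : (presentationLang I).Functions m) : (L.sum (presentationLang I)).Term (Fin n) :=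
  Term.func (Sum.inr i) fun k => Term.var (σ k)

lemma relMap_iff_of_realize_iff {L' : FirstOrder.Language.{u, u}} {M M' : Type u}
    [L'.Structure M] [L'.Structure M'] {n : ℕ} {b : Fin n → M} {b' : Fin n → M'}
    (h : ∀ φ : L'.Formula (Fin n), φ.Realize b ↔ φ.Realize b') {k : ℕ} (R : L'.Relations k)
    (t : Fin k → L'.Term (Fin n)) :
    RelMap R (fun i => (t i).realize b) ↔ RelMap R (fun i => (t i).realize b') := by
  simpa only [Formula.realize_rel] using h (R.formula t)

/-- Embeddings of `L`-structures given by terms transfer along equality of types. -/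
lemma exists_embedding_realize {M M' : Type u} (S : (L.sum (presentationLang I)).Structure M)
    (S' : (L.sum (presentationLang I)).Structure M') {n : ℕ} {b : Fin n → M} {b' : Fin n → M'}
    (h : ∀ φ : (L.sum (presentationLang I)).Formula (Fin n), φ.Realize b ↔ φ.Realize b')
    {Q : Struct L} (q : Q ↪[L] red S) (t : Q → (L.sum (presentationLang I)).Term (Fin n))
    (ht : ∀ x, (t x).realize b = q x) :
    ∃ q' : Q ↪[L] red S', ∀ x, q' x = (t x).realize b' := by
  have heq : ∀ t₁ t₂ : (L.sum (presentationLang I)).Term (Fin n),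
      t₁.realize b = t₂.realize b ↔ t₁.realize b' = t₂.realize b' := fun t₁ t₂ => by
    simpa using h (t₁.equal t₂)
  refine ⟨⟨⟨fun x => Term.realize (M := M') b' (t x), fun x y hxy => q.injective ?_⟩,
    fun F x => ?_, fun {k} R x => ?_⟩, fun x => rfl⟩
  · rw [← ht x, ← ht y]
    exact (heq _ _).2 hxy
  · refine (heq (t (funMap F x)) (Term.func (Sum.inl F) fun i => t (x i))).1 ?_
    rw [ht, q.map_fun]
    exact congrArg (S.funMap (Sum.inl F)) (funext fun i => (ht (x i)).symm)
  · rw [← q.map_rel]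
    have := relMap_iff_of_realize_iff h (Sum.inl R) fun i => t (x i)
    simp only [ht] at this
    exact this.symm

lemma IsGoodAt.of_realize_iff {K : AEC L} {M M' : Type u}
    {S : (L.sum (presentationLang I)).Structure M}
    {S' : (L.sum (presentationLang I)).Structure M'} {n : ℕ} {b : Fin n → M} {b' : Fin n → M'}
    (h : ∀ φ : (L.sum (presentationLang I)).Formula (Fin n), φ.Realize b ↔ φ.Realize b')
    (hb : IsGoodAt K S b) : IsGoodAt K S' b' := by
  have heq : ∀ t₁ t₂ : (L.sum (presentationLang I)).Term (Fin n),
      t₁.realize b = t₂.realize b ↔ t₁.realize b' = t₂.realize b' := fun t₁ t₂ => by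
    simpa using h (t₁.equal t₂)
  have hflag : flag S ↔ flag S' := by
    have := relMap_iff_of_realize_iff h (flagSymbol L I) Fin.elim0
    rw [Subsingleton.elim (fun i => _) (default : _ → M),
      Subsingleton.elim (fun i => _) (default : _ → M')] at this
    exact this
  have hne : Nonempty M ↔ Nonempty M' := by
    have := h (BoundedFormula.ex ⊤)
    simpa [Formula.Realize] using this
  refine ⟨fun i => ?_, fun m σ hm => ?_, hb.2.2.imp hne.1 hflag.1⟩
  · obtain ⟨j, hj⟩ := hb.1 i
    exact ⟨j, (heq (hullTerm L id j) (Term.var i)).1 hj⟩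
  · obtain ⟨P, Q, f, q, hf, hA, hB⟩ := hb.2.1 m σ (hm.imp_right hflag.2)
    have hQ : ∀ x, ∃ i, interp S n i b = q x := fun x => hB.subset ⟨x, rfl⟩
    choose i hi using hQ
    obtain ⟨q', hq'⟩ := exists_embedding_realize S S' h q (fun x => hullTerm L id (i x)) hi
    have key : ∀ {k : ℕ} (τ : Fin k → Fin n) (j : (presentationLang I).Functions k) (x : Q),
        q x = interp S k j (b ∘ τ) ↔ q' x = interp S' k j (b' ∘ τ) := fun τ j x => by
      rw [hq', ← hi]
      exact heq (hullTerm L id (i x)) (hullTerm L τ j)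
    refine ⟨P, Q, f, q', hf, Set.Subset.antisymm ?_ ?_, Set.Subset.antisymm ?_ ?_⟩
    · rintro - ⟨x, rfl⟩
      obtain ⟨j, hj⟩ := hA.subset ⟨x, rfl⟩
      exact ⟨j, ((key σ j (f x)).1 hj.symm).symm⟩
    · rintro - ⟨j, rfl⟩
      obtain ⟨x, hx⟩ := hA.symm.subset ⟨j, rfl⟩
      exact ⟨x, (key σ j (f x)).1 hx⟩
    · rintro - ⟨x, rfl⟩
      exact ⟨i x, (hq' x).symm⟩
    · rintro - ⟨j, rfl⟩
      obtain ⟨x, hx⟩ := hB.symm.subset ⟨j, rfl⟩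
      exact ⟨x, (key id j x).1 hx⟩

/-- The partial types which are not realized by any tuple satisfying `IsGoodAt`. -/
def badTypes (K : AEC L) (I : Type u) :
    Set (Σ n : ℕ, Set ((L.sum (presentationLang I)).Formula (Fin n))) :=
  {p | ∀ (M : Type u) (S : (L.sum (presentationLang I)).Structure M) (v : Fin p.1 → M),
    (∀ φ ∈ p.2, φ.Realize v) → ¬ IsGoodAt K S v}

lemma modelsOmitting_badTypes_iff {K : AEC L} {M : Type u}
    {S : (L.sum (presentationLang I)).Structure M} :
    ModelsOmitting (L.sum (presentationLang I)) ∅ (badTypes K I) M ↔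
      IsGood K (red S) (interp S) (flag S) := by
  rw [isGood_iff]
  constructor
  · intro h n b
    by_contra hb
    have hbad : ⟨n, {φ | φ.Realize b}⟩ ∈ badTypes K I := fun M' S' v hv hgood =>
      hb (hgood.of_realize_iff fun φ =>
        ⟨fun h => by_contra fun hφ => hv φ.not hφ h, hv φ⟩)
    obtain ⟨φ, hφ, hφb⟩ := h.2 _ hbad b
    exact hφb hφ
  · intro h
    refine ⟨fun ψ hψ => hψ.elim, fun p hp v => ?_⟩
    by_contra! hv
    exact hp M S v hv (h p.1 v)

lemma card_sum_presentationLang (K : AEC L) (hI : #I = K.ls) :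
    (L.sum (presentationLang I)).card = K.ls := by
  have hle : (presentationLang I).card ≤ K.ls := by
    rw [card_eq_card_functions_add_card_relations]
    refine add_le_of_le K.aleph0_le_ls ?_ ?_
    · simp only [lift_id]
      refine (Cardinal.sum_le_sum _ (fun _ => #I) fun n => mk_subtype_le _).trans ?_
      rw [sum_const]
      simp [hI, K.aleph0_le_ls]
    · simp only [lift_id]
      refine (Cardinal.sum_le_sum _ (fun _ => 1) fun n => (mk_subtype_le _).trans ?_).trans ?_
      · simp
      · simp [K.aleph0_le_ls]
  have hge : K.ls ≤ (presentationLang I).card := by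
    rw [← hI]
    exact mk_le_of_injective
      (f := fun i : I => (Sum.inl ⟨1, ⟨i, one_ne_zero⟩⟩ : (presentationLang I).Symbols))
      fun i j hij => congrArg Subtype.val (eq_of_heq (Sigma.mk.inj (Sum.inl.inj hij)).2)
  rw [card_sum, lift_id, lift_id, hle.antisymm hge]
  exact add_eq_right K.aleph0_le_ls K.card_le_ls

lemma card_badTypes_le (K : AEC L) (hI : #I = K.ls) : #(badTypes K I) ≤ 2 ^ K.ls := by
  have h2 : ℵ₀ ≤ 2 ^ K.ls := K.aleph0_le_ls.trans (cantor _).le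
  refine (mk_set_le _).trans ?_
  rw [mk_sigma]
  refine (Cardinal.sum_le_sum _ (fun _ => 2 ^ K.ls) fun n => ?_).trans ?_
  · rw [mk_set]
    refine power_le_power_left two_ne_zero ?_
    have hφ : #((L.sum (presentationLang I)).Formula (Fin n)) ≤
        #(Σ k, (L.sum (presentationLang I)).BoundedFormula (Fin n) k) :=
      mk_le_of_injective (f := fun φ => ⟨0, φ⟩) fun φ ψ h => by simpa using h
    refine hφ.trans (BoundedFormula.card_le.trans (max_le K.aleph0_le_ls ?_))
    rw [card_sum_presentationLang K hI]
    refine add_le_of_le K.aleph0_le_ls ?_ (by simp)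
    simpa using (natCast_lt_aleph0).le.trans K.aleph0_le_ls
  · rw [sum_const]
    simp [h2]

/-- The expansion of an `L`-structure by given interpretations of the added symbols. -/
@[reducible] def expand (N : Struct L) (F : Interp I N) (E : Prop) :
    (L.sum (presentationLang I)).Structure N where
  funMap := fun {n} f a => Sum.elim (fun f => funMap f a) (fun i => F n i a) f
  RelMap := fun R a => Sum.elim (fun R => RelMap R a) (fun _ => E) R

lemma hull_comp_embedding {M N : Type u} {S : (L.sum (presentationLang I)).Structure M}
    {T : (L.sum (presentationLang I)).Structure N}
    (f : M ↪[L.sum (presentationLang I)] N) {n : ℕ} (a : Fin n → M) :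
    hull (interp T) (f ∘ a) = f '' hull (interp S) a := by
  rw [hull, hull, ← Set.range_comp]
  congr 1
  exact funext fun i => (f.map_fun (Sum.inr i : (L.sum (presentationLang I)).Functions n) a).symm

lemma flag_iff_of_embedding {M N : Type u} {S : (L.sum (presentationLang I)).Structure M}
    {T : (L.sum (presentationLang I)).Structure N}
    (f : M ↪[L.sum (presentationLang I)] N) : flag S ↔ flag T := by
  have := f.map_rel (flagSymbol L I) default
  rw [Subsingleton.elim (f ∘ default) default] at this
  exact this.symm

lemma strong_reductEmb {K : AEC L} {M N : Type u} {S : (L.sum (presentationLang I)).Structure M}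
    {T : (L.sum (presentationLang I)).Structure N} (f : M ↪[L.sum (presentationLang I)] N)
    (hM : IsGood K (red S) (interp S) (flag S)) (hN : IsGood K (red T) (interp T) (flag T)) :
    K.Strong (M := red S) (N := red T) (@reductEmb L _ LHom.sumInl M N S T f) := by
  refine hM.directed_union.2.2 (red T) _ fun n (a : Fin n → M) hn => ?_
  have := hN.directed_union.2.1 n (f ∘ a) (hn.imp_right (flag_iff_of_embedding f).1)
  exact (congrArg (K.StrongSub (red T) · Set.univ) (hull_comp_embedding f a)).mp this

lemma exists_embedding_expand {M : Type u} (S : (L.sum (presentationLang I)).Structure M)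
    {N : Struct L} (g : red S ↪[L] N) {F : Interp I N}
    (hF : ∀ n i (a : Fin n → M), F n i (g ∘ a) = g (interp S n i a)) :
    ∃ j : @Embedding (L.sum (presentationLang I)) M N S (expand N F (flag S)), ⇑j = ⇑g := by
  refine ⟨@Embedding.mk _ _ _ S (expand N F (flag S)) g.toEmbedding ?_ ?_, rfl⟩
  · rintro n (f | i) x
    · exact g.map_fun f x
    · exact (hF n i x).symm
  · rintro n (R | ⟨⟨⟩, rfl⟩) x
    · exact g.map_rel R x
    · exact iff_of_eq (congrArg (S.RelMap (flagSymbol L I)) (Subsingleton.elim _ _))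

lemma exists_expansion {K : AEC L} (hI : #I = K.ls) {N : Struct L} (hN : K.Mem N) :
    ∃ (F : Interp I N) (E : Prop), IsGood K N F E := by
  have h0 : IsSystemOn K N (fun n (i : (presentationLang I).Functions n) a =>
      a ⟨0, Nat.pos_of_ne_zero i.2⟩) ∅ := by
    have key : ∀ n (a : Fin n → N), Set.range a ⊆ ∅ → n = 0 := fun n a ha => by
      by_contra hn
      exact ha ⟨⟨0, Nat.pos_of_ne_zero hn⟩, rfl⟩
    refine ⟨fun n a ha i => (ha ⟨i, rfl⟩).elim, fun m n a b hb hab => ?_,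
      fun n a hn ha => absurd (key n a ha) hn⟩
    obtain rfl := key m a (hab.trans hb)
    rw [hull_zero]
    exact Set.empty_subset _
  obtain ⟨F, hF, -⟩ := h0.exists_extension hI hN
  refine ⟨F, IsEmpty N, hF.isGood (fun _ => ?_) (isEmpty_or_nonempty N).symm⟩
  have := AEC.Strong.strongSub (K.strong_refl hN)
  rwa [Set.range_eq_empty] at this

lemma IsGood.exists_extension {K : AEC L} (hI : #I = K.ls) {M N : Struct L} {g : M ↪[L] N}
    (hg : K.Strong g) {F : Interp I M} {E : Prop} (h : IsGood K M F E) :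
    ∃ F' : Interp I N, IsGood K N F' E ∧ ∀ n i (a : Fin n → M), F' n i (g ∘ a) = g (F n i a) := by
  let G : Interp I N := fun n i => Function.extend (fun a : Fin n → M => g ∘ a)
    (fun a => g (F n i a)) fun a => a ⟨0, Nat.pos_of_ne_zero i.2⟩
  have hG : ∀ n i (a : Fin n → M), G n i (g ∘ a) = g (F n i a) := fun n i a =>
    (g.injective.comp_left).extend_apply _ _ a
  have hGh : ∀ n (a : Fin n → M), hull G (g ∘ a) = g '' hull F a := fun n a => by
    rw [hull, hull, ← Set.range_comp]
    exact congrArg Set.range (funext fun i => hG n i a)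
  have hlift : ∀ n (a : Fin n → N), Set.range a ⊆ Set.range g → ∃ a' : Fin n → M, g ∘ a' = a :=
    fun n a ha => by
      choose a' ha' using fun i => ha ⟨i, rfl⟩
      exact ⟨a', funext ha'⟩
  have hsys : IsSystemOn K N G (Set.range g) := by
    refine ⟨fun n a ha i => ?_, fun m n a b hb hab => ?_, fun n a hn ha => ?_⟩
    · obtain ⟨a, rfl⟩ := hlift n a ha
      rw [hGh]
      exact Set.mem_image_of_mem g (h.mem_hull n a i)
    · obtain ⟨b, rfl⟩ := hlift n b hb
      obtain ⟨a, rfl⟩ := hlift m a (hab.trans hb)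
      rw [hGh, hGh]
      by_cases hm : m = 0
      · subst hm
        simp [hull_zero]
      · rw [Set.range_comp, Set.range_comp, Set.image_subset_image_iff g.injective] at hab
        exact Set.image_mono (h.strong m n a b (Or.inl hm) hab).subset
    · obtain ⟨a, rfl⟩ := hlift n a ha
      rw [hGh]
      exact (h.directed_union.2.1 n a (Or.inl hn)).image hg
  obtain ⟨F', hF', hF'G⟩ := hsys.exists_extension hI (K.strong_dom g hg).2
  refine ⟨F', hF'.isGood (fun hE => ?_) (h.nonempty_or.imp_left (Nonempty.map g)),
    fun n i a => (hF'G n i _ (Set.range_comp_subset_range _ _)).trans (hG n i a)⟩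
  have := (h.directed_union.2.1 0 Fin.elim0 (Or.inr hE)).image hg
  rwa [hull_zero, Set.image_empty] at this

end Presentation

/-- **Shelah's Presentation Theorem** (with the extension property): for every AEC `K` in a
vocabulary `τ = L` (with `|τ| ≤ LS(K)`, which is part of our definition of an AEC) there are
a vocabulary `τ1 = L.sum L₂ ⊇ τ` of cardinality `LS(K)`, a first-order `τ1`-theory `T1` and
a set `Γ` of at most `2 ^ LS(K)` partial types over the empty set such that:
(1) `K` is exactly the class of `τ`-reducts of models of `T1` omitting `Γ`;
(2) if `M' ⊆ N'` (an embedding of `τ1`-structures) where both model `T1` and omit `Γ`,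
    then `M'↾τ ≺_K N'↾τ`;
(3) if `M ≺_K N` and `M'` is an expansion of `M` modelling `T1` and omitting `Γ`, then there
    is such an expansion `N'` of `N` with `M' ⊆ N'`. -/
theorem shelah_presentation (L : FirstOrder.Language.{u, u}) (K : AEC L) :
    ∃ (L₂ : FirstOrder.Language.{u, u}) (T1 : (L.sum L₂).Theory)
      (Γ : Set (Σ n : ℕ, Set ((L.sum L₂).Formula (Fin n)))),
      (L.sum L₂).card = K.ls ∧ #Γ ≤ 2 ^ K.ls ∧
      -- (1) `K` is the class of reducts of models of `T1` omitting `Γ`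
      (∀ M : Struct L, K.Mem M ↔
        ∃ S : (L.sum L₂).Structure M,
          @ModelsOmitting (L.sum L₂) T1 Γ M S ∧
          @LHom.reduct L (L.sum L₂) LHom.sumInl M S = M.str) ∧
      -- (2) embeddings of models of `T1` omitting `Γ` reduce to strong embeddings
      (∀ (M N : Type u) (SM : (L.sum L₂).Structure M) (SN : (L.sum L₂).Structure N)
        (f : @FirstOrder.Language.Embedding (L.sum L₂) M N SM SN),
        @ModelsOmitting (L.sum L₂) T1 Γ M SM → @ModelsOmitting (L.sum L₂) T1 Γ N SN →
        @AEC.Strong L K ⟨M, @LHom.reduct L (L.sum L₂) LHom.sumInl M SM⟩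
          ⟨N, @LHom.reduct L (L.sum L₂) LHom.sumInl N SN⟩
          (@reductEmb L (L.sum L₂) LHom.sumInl M N SM SN f)) ∧
      -- (3) expansions of strong submodels extend to expansions of the larger model
      (∀ (M N : Struct L) (g : M ↪[L] N), K.Strong g →
        ∀ SM : (L.sum L₂).Structure M,
          @LHom.reduct L (L.sum L₂) LHom.sumInl M SM = M.str →
          @ModelsOmitting (L.sum L₂) T1 Γ M SM →
          ∃ SN : (L.sum L₂).Structure N,
            @LHom.reduct L (L.sum L₂) LHom.sumInl N SN = N.str ∧
            @ModelsOmitting (L.sum L₂) T1 Γ N SN ∧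
            ∃ j : @FirstOrder.Language.Embedding (L.sum L₂) M N SM SN, ⇑j = ⇑g) := by
  have hI : #K.ls.out = K.ls := mk_out _
  refine ⟨presentationLang K.ls.out, ∅, badTypes K K.ls.out, card_sum_presentationLang K hI,
    card_badTypes_le K hI, fun M => ⟨fun hM => ?_, ?_⟩, fun M N SM SN f hM hN => ?_,
    fun M N g hg SM hSM hM => ?_⟩
  · obtain ⟨F, E, h⟩ := exists_expansion hI hM
    exact ⟨expand M F E, modelsOmitting_badTypes_iff.2 h, rfl⟩
  · rintro ⟨S, hS, hSM⟩
    obtain ⟨M, str⟩ := M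
    change (L.sum _).Structure M at S
    change @LHom.reduct L _ LHom.sumInl M S = str at hSM
    change @ModelsOmitting _ _ _ M S at hS
    subst hSM
    exact (modelsOmitting_badTypes_iff.1 hS).directed_union.1
  · exact strong_reductEmb f (modelsOmitting_badTypes_iff.1 hM) (modelsOmitting_badTypes_iff.1 hN)
  · obtain ⟨M, str⟩ := M
    change (L.sum _).Structure M at SM
    change @LHom.reduct L _ LHom.sumInl M SM = str at hSM
    change @ModelsOmitting _ _ _ M SM at hM
    subst hSM
    have hgood := modelsOmitting_badTypes_iff.1 hM
    obtain ⟨F', hF', hext⟩ := hgood.exists_extension hI hg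
    exact ⟨expand N F' (flag SM), rfl, modelsOmitting_badTypes_iff.2 hF',
      exists_embedding_expand SM g hext⟩

end Paper
end

section
/- Suppose K is an AEC with LS(K) < κ. Then: (a) if κ is weakly compact and K has the amalgamation property for models of size in [LS(K),κ), then K has the amalgamation property for models of size in [LS(K),κ]; (b) if κ is measurable, cf(λ) = κ, and K has the amalgamation property for models of size in [LS(K),λ), then K has the amalgamation property for models of size in [LS(K),λ]; (c) if κ is λ-strongly compact and K has the amalgamation property for models of size in [LS(K),κ), then K has the amalgamation property for models of size in [LS(K),λ]. -/
universe u

open FirstOrder Cardinal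

namespace Paper

/-- A filter is `κ`-complete if it is closed under intersections of fewer than `κ` sets. -/
def FilterComplete {α : Type u} (F : Filter α) (κ : Cardinal.{u}) : Prop :=
  ∀ S : Set (Set α), #S < κ → (∀ s ∈ S, s ∈ F) → ⋂₀ S ∈ F

/-- `κ` is strongly compact iff every (proper) `κ`-complete filter on any set extends to a
`κ`-complete ultrafilter. -/
def IsStronglyCompactCard (κ : Cardinal.{u}) : Prop :=
  ∀ (α : Type u) (F : Filter α), F.NeBot → FilterComplete F κ →
    ∃ U : Ultrafilter α, FilterComplete (U : Filter α) κ ∧ F ≤ (U : Filter α)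

end Paper
namespace Paper

variable {L : FirstOrder.Language.{u, u}}

/-- `M` is an `F`-amalgamation base: `M ∈ K` and every pair of `≺_K`-extensions of `M`
lying in `K_F` can be amalgamated over `M`. -/
def AEC.AB (K : AEC L) (F : Set Cardinal.{u}) (M : Struct L) : Prop :=
  K.Mem M ∧
  ∀ (M1 M2 : Struct L) (e1 : M ↪[L] M1) (e2 : M ↪[L] M2),
    K.Mem M1 → K.Mem M2 → #M1 ∈ F → #M2 ∈ F → K.Strong e1 → K.Strong e2 →
    ∃ (N : Struct L) (f1 : M1 ↪[L] N) (f2 : M2 ↪[L] N),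
      K.Mem N ∧ K.Strong f1 ∧ K.Strong f2 ∧ f1.comp e1 = f2.comp e2

end Paper
namespace Paper

/-- Formulas of the infinitary logic `L_{κ,κ}` in the vocabulary `L`, with free variables
from the type `α`: first-order (in particular atomic) formulas, negation, conjunctions over
index sets of size `< κ`, and quantification over blocks of `< κ` variables. -/
inductive LKK (L : FirstOrder.Language.{u, u}) (κ : Cardinal.{u}) : Type u → Type (u + 1)
  | of {α : Type u} (φ : L.Formula α) : LKK L κ α
  | not {α : Type u} : LKK L κ α → LKK L κ α
  | conj {α : Type u} (ι : Type u) (h : #ι < κ) (f : ι → LKK L κ α) : LKK L κ α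
  | all {α : Type u} (β : Type u) (h : #β < κ) : LKK L κ (α ⊕ β) → LKK L κ α

variable {L : FirstOrder.Language.{u, u}} {κ : Cardinal.{u}}

/-- Satisfaction for `L_{κ,κ}`-formulas. -/
def LKK.Realize {M : Type u} [L.Structure M] : ∀ {α : Type u}, LKK L κ α → (α → M) → Prop
  | _, .of φ, v => φ.Realize v
  | _, .not φ, v => ¬ LKK.Realize φ v
  | _, .conj _ _ f, v => ∀ i, LKK.Realize (f i) v
  | _, .all β _ φ, v => ∀ w : β → M, LKK.Realize φ (Sum.elim v w)

/-- Satisfiability of a set of `L_{κ,κ}`-sentences. -/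
def LKKSatisfiable (Φ : Set (LKK L κ PEmpty.{u + 1})) : Prop :=
  ∃ M : Struct L, Nonempty M ∧ ∀ φ ∈ Φ, LKK.Realize (M := M) φ (fun x => x.elim)

/-- `κ` is weakly compact: it is strongly inaccessible and every set of `κ` many
`L_{κ,κ}`-sentences that is `< κ`-satisfiable is satisfiable. -/
def IsWeaklyCompactCard (κ : Cardinal.{u}) : Prop :=
  κ.IsInaccessible ∧
  ∀ (L : FirstOrder.Language.{u, u}) (Φ : Set (LKK L κ PEmpty.{u + 1})),
    #Φ ≤ Cardinal.lift.{u + 1} κ →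
    (∀ Φ₀ ⊆ Φ, #Φ₀ < Cardinal.lift.{u + 1} κ → LKKSatisfiable Φ₀) → LKKSatisfiable Φ

end Paper
namespace Paper

/-- `κ` is measurable: there is a `κ`-additive non-trivial `{0,1}`-valued measure on the
power set of `κ`, i.e. a `κ`-complete nonprincipal ultrafilter on a set of size `κ`. -/
def IsMeasurableCard (κ : Cardinal.{u}) : Prop :=
  ∃ (α : Type u) (U : Ultrafilter α), #α = κ ∧
    FilterComplete (U : Filter α) κ ∧ ∀ a : α, (U : Ultrafilter α) ≠ pure a

/-- `κ` is `λ`-strongly compact: there is a `κ`-complete fine ultrafilter on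
`P_κ(λ) = {σ ⊆ λ : |σ| < κ}`. -/
def IsLamStronglyCompact (κ lam : Cardinal.{u}) : Prop :=
  ∀ A : Type u, #A = lam →
    ∃ U : Ultrafilter {s : Set A // #s < κ},
      FilterComplete (U : Filter {s : Set A // #s < κ}) κ ∧
      ∀ a : A, {s : {s : Set A // #s < κ} | a ∈ (s : Set A)} ∈ U

end Paper

namespace Paper

section Embeddings

open FirstOrder.Language

variable {L : FirstOrder.Language.{u, u}}

/-- An embedding whose range is contained in the range of another one factors through it. -/
theorem exists_comp_eq_of_range_subset {A B N : Struct L} (f : A ↪[L] N) (g : B ↪[L] N)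
    (h : Set.range f ⊆ Set.range g) : ∃ j : A ↪[L] B, g.comp j = f := by
  choose j hj using fun a => h (Set.mem_range_self a)
  refine ⟨⟨⟨j, fun a b hab => f.injective ?_⟩, fun F x => g.injective ?_, fun R x => ?_⟩, ?_⟩
  · rw [← hj a, ← hj b, hab]
  · change g (j _) = g _
    rw [hj, f.map_fun, g.map_fun]
    congr 1
    funext i
    exact (hj _).symm
  · change Structure.RelMap R (j ∘ x) ↔ _
    rw [← g.map_rel, ← f.map_rel]
    have : g ∘ j ∘ x = f ∘ x := funext fun i => hj _
    rw [this]
  · ext a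
    exact hj a

theorem AEC.exists_strong_comp_eq (K : AEC L) {A B N : Struct L} (f : A ↪[L] N) (g : B ↪[L] N)
    (hf : K.Strong f) (hg : K.Strong g) (h : Set.range f ⊆ Set.range g) :
    ∃ j : A ↪[L] B, K.Strong j ∧ g.comp j = f := by
  obtain ⟨j, hj⟩ := exists_comp_eq_of_range_subset f g h
  exact ⟨j, K.coherence j g hg (hj ▸ hf), hj⟩

theorem AEC.strong_of_range_eq (K : AEC L) {A B N : Struct L} (f : A ↪[L] N) (g : B ↪[L] N)
    (hg : K.Strong g) (h : Set.range f = Set.range g) : K.Strong f := by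
  obtain ⟨j, hj⟩ := exists_comp_eq_of_range_subset f g h.subset
  obtain ⟨j', hj'⟩ := exists_comp_eq_of_range_subset g f h.superset
  have hj1 : ∀ a, g (j a) = f a := fun a => DFunLike.congr_fun hj a
  have hj2 : ∀ b, f (j' b) = g b := fun b => DFunLike.congr_fun hj' b
  have h1 : ∀ a, j' (j a) = a := fun a => f.injective (by rw [hj2, hj1])
  have h2 : ∀ b, j (j' b) = b := fun b => g.injective (by rw [hj1, hj2])
  let e : A ≃[L] B := ⟨⟨j, j', h1, h2⟩, fun F x => j.map_fun F x, fun R x => j.map_rel R x⟩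
  have hA : K.Mem A := K.mem_iso e.symm (K.strong_dom g hg).1
  have : g.comp e.toEmbedding = f := by
    ext a
    exact hj1 a
  exact this ▸ K.strong_iso_comp e g hA hg

/-- A map between enumerated structures preserving atomic facts is an embedding. -/
theorem exists_embedding_of_atomic {A N : Struct L} {Λ : Type u} (a : Λ → A)
    (ha : Function.Surjective a) (b : Λ → N) (heq : ∀ α β, a α = a β ↔ b α = b β)
    (hrel : ∀ (n : ℕ) (R : L.Relations n) (x : Fin n → Λ),
      Structure.RelMap R (a ∘ x) ↔ Structure.RelMap R (b ∘ x))
    (hfun : ∀ (n : ℕ) (F : L.Functions n) (x : Fin n → Λ) (α : Λ),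
      Structure.funMap F (a ∘ x) = a α ↔ Structure.funMap F (b ∘ x) = b α) :
    ∃ g : A ↪[L] N, ∀ α, g (a α) = b α := by
  choose s hs using ha
  have key : ∀ α, b (s (a α)) = b α := fun α => (heq _ _).1 (hs _)
  have has : ∀ {n : ℕ} (x : Fin n → A), a ∘ s ∘ x = x := fun x => funext fun i => hs _
  refine ⟨⟨⟨b ∘ s, fun x y hxy => ?_⟩, fun {n} F x => ?_, fun {n} R x => ?_⟩, key⟩
  · rw [← hs x, ← hs y]
    exact (heq _ _).2 hxy
  · refine ((hfun n F (s ∘ x) (s (Structure.funMap F x))).1 ?_).symm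
    rw [has, hs]
  · have := hrel n R (s ∘ x)
    rw [has] at this
    exact this.symm

end Embeddings

section DirectedSystems

open FirstOrder.Language

variable {L : FirstOrder.Language.{u, u}}

/-- A map out of a directed union of strong submodels which is strong on each of them is strong. -/
theorem AEC.exists_strong_of_directed (K : AEC L) {M P : Struct L} (hM : K.Mem M) (hP : K.Mem P)
    {I : Type u} [Preorder I] [IsDirectedOrder I] [Nonempty I] (X : I → Struct L)
    (u : ∀ i, X i ↪[L] M) (hu : ∀ i, K.Strong (u i))
    (hmono : ∀ i j, i ≤ j → Set.range (u i) ⊆ Set.range (u j))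
    (hcov : ∀ x, ∃ i, x ∈ Set.range (u i)) (ρ : M → P)
    (hρ : ∀ i, ∃ r : X i ↪[L] P, K.Strong r ∧ ∀ x, r x = ρ (u i x)) :
    ∃ f : M ↪[L] P, K.Strong f ∧ ∀ x, f x = ρ x := by
  choose t ht htu using fun i j hij =>
    K.exists_strong_comp_eq (u i) (u j) (hu i) (hu j) (hmono i j hij)
  have htu' : ∀ i j hij x, u j (t i j hij x) = u i x :=
    fun i j hij x => DFunLike.congr_fun (htu i j hij) x
  choose r hr hru using hρ
  obtain ⟨Q, g, -, -, -, -, huniv⟩ := K.chain_union I inferInstance inferInstance X t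
    (fun i => (K.strong_dom _ (hu i)).1) ht (fun i j k hij hjk => by
      ext x
      apply (u k).injective
      change u k (t j k hjk (t i j hij x)) = _
      rw [htu', htu', htu'])
  obtain ⟨v, hv, hvg⟩ := huniv M u hM hu htu
  obtain ⟨w, hw, hwg⟩ := huniv P r hP hr (fun i j hij => by
    ext x
    change r j (t i j hij x) = _
    rw [hru, hru, htu'])
  have hvg' : ∀ i x, v (g i x) = u i x := fun i x => DFunLike.congr_fun (hvg i) x
  have hwg' : ∀ i x, w (g i x) = r i x := fun i x => DFunLike.congr_fun (hwg i) x
  obtain ⟨j, hj, hvj⟩ := K.exists_strong_comp_eq (Embedding.refl L M) v (K.strong_refl hM) hv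
    (by
      rintro x -
      obtain ⟨i, y, rfl⟩ := hcov x
      exact ⟨g i y, hvg' i y⟩)
  refine ⟨w.comp j, K.strong_comp _ _ hj hw, fun x => ?_⟩
  obtain ⟨i, y, rfl⟩ := hcov x
  have : j (u i y) = g i y := by
    apply v.injective
    rw [hvg']
    exact DFunLike.congr_fun hvj _
  change w (j (u i y)) = _
  rw [this, hwg', hru]

theorem mk_iUnion_le_of_le {α ι : Type u} {c : Cardinal.{u}} (hc : ℵ₀ ≤ c) (f : ι → Set α)
    (hι : #ι ≤ c) (hf : ∀ i, #(f i) ≤ c) : #(⋃ i, f i) ≤ c :=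
  (mk_iUnion_le f).trans ((mul_le_mul' hι (ciSup_le' hf)).trans (mul_eq_self hc).le)

/-- Small sets can be covered by a monotone system of small strong submodels. -/
theorem AEC.exists_finset_system (K : AEC L) {N : Struct L} (hN : K.Mem N) [Nonempty N]
    {β : Type u} (c : β → Set N) (hc : ∀ b, #(c b) ≤ K.ls) :
    ∃ (S : Finset β → Struct L) (k : ∀ F, S F ↪[L] N),
      (∀ F, K.Strong (k F)) ∧ (∀ F, #(S F) ≤ K.ls) ∧ (∀ F, Nonempty (S F)) ∧
      (∀ F G, F ⊆ G → Set.range (k F) ⊆ Set.range (k G)) ∧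
      ∀ F, ∀ b ∈ F, c b ⊆ Set.range (k F) := by
  classical
  obtain ⟨pt⟩ := ‹Nonempty N›
  have hω := K.aleph0_le_ls
  choose S k _ hk hsub hcard using fun A : Set N => K.loewenheim_skolem N hN A
  let step : ∀ F : Finset β, (∀ G, G ⊂ F → Set N) → Set N := fun F T =>
    Set.range (k ({pt} ∪ (⋃ b : F, c b) ∪ ⋃ G : {G // G ⊂ F}, T G G.2))
  let T : Finset β → Set N := fun F => F.strongInduction step
  let Y : Finset β → Set N := fun F => {pt} ∪ (⋃ b : F, c b) ∪ ⋃ G : {G // G ⊂ F}, T G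
  have hT : ∀ F, T F = Set.range (k (Y F)) := fun F => Finset.strongInduction_eq step F
  have hY : ∀ F, #(Y F) ≤ K.ls := by
    intro F
    induction F using Finset.strongInduction with
    | H F ih =>
      have hfin : Finite {G // G ⊂ F} :=
        Set.Finite.subset (Finset.finite_toSet F.powerset)
          fun G (hG : G ⊂ F) => by simpa using hG.subset
      have h1 : #({pt} : Set N) ≤ K.ls := by
        rw [mk_singleton]
        exact one_le_aleph0.trans hω
      have h2 : #(⋃ b : F, c b) ≤ K.ls :=
        mk_iUnion_le_of_le hω _ ((lt_aleph0_of_finite _).le.trans hω) fun b => hc b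
      have h3 : #(⋃ G : {G // G ⊂ F}, T G) ≤ K.ls := by
        refine mk_iUnion_le_of_le hω _ ((lt_aleph0_of_finite _).le.trans hω) fun G => ?_
        rw [hT]
        exact mk_range_le.trans ((hcard _).trans (add_le_of_le hω (ih G G.2) le_rfl))
      exact (mk_union_le _ _).trans
        (add_le_of_le hω ((mk_union_le _ _).trans (add_le_of_le hω h1 h2)) h3)
  refine ⟨fun F => S (Y F), fun F => k (Y F), fun F => hk _,
    fun F => (hcard _).trans (add_le_of_le hω (hY F) le_rfl), fun F => ?_, fun F G hFG => ?_,
    fun F b hb => ?_⟩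
  · obtain ⟨x, -⟩ := hsub (Y F) (Or.inl (Or.inl rfl))
    exact ⟨x⟩
  · rcases hFG.eq_or_ssubset with rfl | h
    · exact subset_rfl
    · rw [← hT F]
      exact (Set.subset_iUnion (fun G' : {G' // G' ⊂ G} => T G') ⟨F, h⟩).trans
        (Set.subset_union_right.trans (hsub _))
  · exact (Set.subset_iUnion (fun b : F => c b) ⟨b, hb⟩).trans
      ((Set.subset_union_right.trans Set.subset_union_left).trans (hsub _))

end DirectedSystems

section Limits

open FirstOrder.Language

/-- Any family of `{0,1}`-valuations of `θ` many propositional variables, indexed by `I`, has a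
limit valuation: on every set of fewer than `κ` variables it coincides with a valuation of the
family, whose index may moreover be chosen in fewer than `κ` prescribed sets `{i | b ∈ A i}`. -/
def LimitProp (κ θ : Cardinal.{u}) {I B : Type u} (A : I → Set B) : Prop :=
  ∀ J : Type u, #J ≤ θ → ∀ v : I → J → Prop, ∃ w : J → Prop,
    ∀ (s : Set J) (y : Set B), #s < κ → #y < κ → ∃ i, y ⊆ A i ∧ ∀ j ∈ s, v i j ↔ w j

/-- A truth assignment to the atomic statements about a set `C` of names. -/
structure AtomicType (L : FirstOrder.Language.{u, u}) (C : Type u) where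
  eq : C → C → Prop
  rel : ∀ n : ℕ, L.Relations n → (Fin n → C) → Prop
  func : ∀ n : ℕ, L.Functions n → (Fin n → C) → C → Prop

variable {L : FirstOrder.Language.{u, u}} {C : Type u}

/-- The atomic type realized by an interpretation of the names. -/
def AtomicType.of {N : Struct L} (ev : C → N) : AtomicType L C where
  eq c d := ev c = ev d
  rel _ R x := Structure.RelMap R (ev ∘ x)
  func _ F x c := Structure.funMap F (ev ∘ x) = ev c

/-- Two atomic types agree on all statements involving only names from `D`. -/
structure AtomicType.AgreeOn (T T' : AtomicType L C) (D : Set C) : Prop where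
  eq : ∀ c ∈ D, ∀ d ∈ D, (T.eq c d ↔ T'.eq c d)
  rel : ∀ (n : ℕ) (R : L.Relations n) (x : Fin n → C), (∀ i, x i ∈ D) →
    (T.rel n R x ↔ T'.rel n R x)
  func : ∀ (n : ℕ) (F : L.Functions n) (x : Fin n → C), (∀ i, x i ∈ D) → ∀ c ∈ D,
    (T.func n F x c ↔ T'.func n F x c)

theorem mk_formula_le {c : Cardinal.{u}} (hc : ℵ₀ ≤ c) (hL : L.card ≤ c) (hC : #C ≤ c) :
    #(L.Formula C) ≤ c := by
  refine (mk_le_of_injective (sigma_mk_injective (β := fun n => L.BoundedFormula C n)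
    (i := 0))).trans (BoundedFormula.card_le.trans ?_)
  simpa using ⟨hc, add_le_of_le hc hC hL⟩

theorem LimitProp.exists_atomicType {κ θ ls : Cardinal.{u}} {I B : Type u} {A : I → Set B}
    (hA : LimitProp κ θ A) (hω : ℵ₀ ≤ ls) (hL : L.card ≤ ls) (hls : ls < κ) (hlsθ : ls ≤ θ)
    (hC : #C ≤ θ) (T : I → AtomicType L C)
    (hT : ∀ i, ∃ (N : Struct L) (ev : C → N), T i = AtomicType.of ev) :
    ∃ W : AtomicType L C, ∀ (D : Set C) (y : Set B), #D ≤ ls → #y ≤ ls →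
      ∃ i, y ⊆ A i ∧ (T i).AgreeOn W D := by
  choose N ev hev using hT
  obtain ⟨w, hw⟩ := hA (L.Formula C) (mk_formula_le (hω.trans hlsθ) (hL.trans hlsθ) hC)
    fun i φ => φ.Realize (ev i)
  refine ⟨⟨fun c d => w (Term.equal (.var c) (.var d)),
    fun n R x => w (R.formula fun i => .var (x i)),
    fun n F x c => w (Term.equal (.func F fun i => .var (x i)) (.var c))⟩, fun D y hD hy => ?_⟩
  obtain ⟨i, hyi, hi⟩ := hw
    (Set.range fun φ : L.Formula D => Formula.relabel (Subtype.val : D → C) φ) y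
    ((mk_range_le.trans (mk_formula_le hω hL hD)).trans_lt hls) (hy.trans_lt hls)
  rw [Set.forall_mem_range] at hi
  refine ⟨i, hyi, ⟨fun c hc d hd => ?_, fun n R x hx => ?_, fun n F x hx c hc => ?_⟩⟩
  · rw [hev]
    refine Iff.trans ?_ (hi (Term.equal (.var ⟨c, hc⟩) (.var ⟨d, hd⟩)))
    rw [Formula.realize_relabel, Formula.realize_equal]
    rfl
  · rw [hev]
    refine Iff.trans ?_ (hi (R.formula fun i => .var ⟨x i, hx i⟩))
    rw [Formula.realize_relabel, Formula.realize_rel]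
    rfl
  · rw [hev]
    refine Iff.trans ?_ (hi (Term.equal (.func F fun i => .var ⟨x i, hx i⟩) (.var ⟨c, hc⟩)))
    rw [Formula.realize_relabel, Formula.realize_equal]
    rfl

/-- If models `N i` of an AEC receive maps `h i` from a set `B` covered by small models `X b`, and
`h i` is strong on `X b` whenever `A i` contains the image of `X b`, then the limit property yields
a single model receiving a map from `B` that is strong on all the `X b`. -/
theorem AEC.exists_limit_model (K : AEC L) {κ θ : Cardinal.{u}} (hls : K.ls < κ) (hlsθ : K.ls ≤ θ)
    {I B : Type u} {A : I → Set B} (hA : LimitProp κ θ A) (hB : #B ≤ θ)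
    {β : Type u} (hβ : #β ≤ θ) (X : β → Struct L)
    (hXcard : ∀ b, #(X b) ≤ K.ls) (nm : ∀ b, X b → B) (hcov : ∀ x, ∃ b, x ∈ Set.range (nm b))
    (N : I → Struct L) (hN : ∀ i, K.Mem (N i)) (hne : ∀ i, Nonempty (N i)) (h : ∀ i, B → N i)
    (hh : ∀ i b, Set.range (nm b) ⊆ A i →
      ∃ q : X b ↪[L] N i, K.Strong q ∧ ∀ x, q x = h i (nm b x)) :
    ∃ (P : Struct L) (ρ : B → P), K.Mem P ∧
      (∀ b, ∃ r : X b ↪[L] P, K.Strong r ∧ ∀ x, r x = ρ (nm b x)) ∧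
      ∀ x y, (∀ i, x ∈ A i → y ∈ A i → h i x = h i y) → ρ x = ρ y := by
  classical
  have hω := K.aleph0_le_ls
  choose S k hk hScard hSne hmono hcS using fun i =>
    K.exists_finset_system (hN i) (fun b => h i '' Set.range (nm b))
      fun b => mk_image_le.trans (mk_range_le.trans (hXcard b))
  let Λ : Type u := K.ls.out
  have hΛ : #Λ = K.ls := mk_out _
  have henum : ∀ i F, ∃ a : Λ → S i F, Function.Surjective a := by
    intro i F
    have := hSne i F
    obtain ⟨e⟩ : Nonempty (S i F ↪ Λ) := by
      rw [← le_def, hΛ]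
      exact hScard i F
    exact ⟨_, Function.invFun_surjective e.injective⟩
  choose en hen using henum
  let C : Type u := (Finset β × Λ) ⊕ B
  let ev : ∀ i, C → N i := fun i => Sum.elim (fun p => k i p.1 (en i p.1 p.2)) (h i)
  have hC : #C ≤ θ := by
    have hθ := hω.trans hlsθ
    have hFin : #(Finset β) ≤ θ := by
      rcases finite_or_infinite β with _ | _
      · exact (lt_aleph0_of_finite _).le.trans hθ
      · rwa [mk_finset_of_infinite]
    have : #C = #(Finset β) * #Λ + #B := by simp [C]
    rw [this]
    exact add_le_of_le hθ ((mul_le_mul' hFin (hΛ.le.trans hlsθ)).trans (mul_eq_self hθ).le) hB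
  obtain ⟨W, hW⟩ := hA.exists_atomicType hω K.card_le_ls hls hlsθ hC
    (fun i => AtomicType.of (ev i)) fun i => ⟨N i, ev i, rfl⟩
  let D : Finset β → Set C := fun F => Set.range fun α : Λ => Sum.inl (F, α)
  have hD : ∀ F, #(D F) ≤ K.ls := fun F => mk_range_le.trans hΛ.le
  have hmemD : ∀ F α, Sum.inl (F, α) ∈ D F := fun F α => ⟨α, rfl⟩
  choose ι _ hι using fun F => hW (D F) ∅ (hD F) (by simp)
  let P : Finset β → Struct L := fun F => S (ι F) F
  let a : ∀ F, Λ → P F := fun F => en (ι F) F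
  have ha : ∀ F, Function.Surjective (a F) := fun F => hen _ _
  have hPmem : ∀ F, K.Mem (P F) := fun F => (K.strong_dom _ (hk _ _)).1
  have heveq : ∀ {i E c d}, (AtomicType.of (ev i)).AgreeOn W E → c ∈ E → d ∈ E →
      (ev i c = ev i d ↔ W.eq c d) := fun hi hc hd => hi.eq _ hc _ hd
  have hrange : ∀ i F, Set.range (k i F) = Set.range fun α => ev i (.inl (F, α)) := by
    intro i F
    ext y
    constructor
    · rintro ⟨x, rfl⟩
      obtain ⟨α, rfl⟩ := hen i F x
      exact ⟨α, rfl⟩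
    · rintro ⟨α, rfl⟩
      exact ⟨_, rfl⟩
  have hemb : ∀ i F E, (AtomicType.of (ev i)).AgreeOn W E → D F ⊆ E →
      ∃ t : P F ↪[L] N i, K.Strong t ∧ (∀ α, t (a F α) = ev i (.inl (F, α))) ∧
        Set.range t = Set.range (k i F) := by
    intro i F E hi hE
    have hka : ∀ {n : ℕ} (x : Fin n → Λ),
        k (ι F) F ∘ a F ∘ x = ev (ι F) ∘ fun j => .inl (F, x j) := fun x => rfl
    obtain ⟨t, ht⟩ := exists_embedding_of_atomic (a F) (ha F) (fun α => ev i (.inl (F, α)))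
      (fun α α' => by
        rw [← (k (ι F) F).injective.eq_iff]
        exact (heveq (hι F) (hmemD F α) (hmemD F α')).trans
          (heveq hi (hE (hmemD F α)) (hE (hmemD F α'))).symm)
      (fun n R x => by
        rw [← (k (ι F) F).map_rel]
        exact ((hι F).rel n R (fun j => .inl (F, x j)) fun j => hmemD F _).trans
          (hi.rel n R (fun j => .inl (F, x j)) fun j => hE (hmemD F _)).symm)
      (fun n f x α => by
        rw [← (k (ι F) F).injective.eq_iff, (k (ι F) F).map_fun]
        exact ((hι F).func n f (fun j => .inl (F, x j)) (fun j => hmemD F _) _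
          (hmemD F α)).trans (hi.func n f (fun j => .inl (F, x j)) (fun j => hE (hmemD F _)) _
          (hE (hmemD F α))).symm)
    have hrt : Set.range t = Set.range (k i F) := by
      rw [hrange, ← (ha F).range_comp]
      exact congrArg Set.range (funext ht)
    exact ⟨t, K.strong_of_range_eq _ _ (hk i F) hrt, ht, hrt⟩
  have hlift : ∀ (Y : Struct L) i G E, (AtomicType.of (ev i)).AgreeOn W E → D G ⊆ E →
      ∀ q : Y ↪[L] N i, K.Strong q → Set.range q ⊆ Set.range (k i G) →
      ∃ r : Y ↪[L] P G, K.Strong r ∧ ∀ x α, r x = a G α ↔ q x = ev i (.inl (G, α)) := by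
    intro Y i G E hi hE q hq hqr
    obtain ⟨t, ht, hta, htr⟩ := hemb i G E hi hE
    obtain ⟨r, hr, hrq⟩ := K.exists_strong_comp_eq q t hq ht (hqr.trans htr.superset)
    refine ⟨r, hr, fun x α => ?_⟩
    rw [← t.injective.eq_iff, hta, ← hrq]
    rfl
  have htrans : ∀ F G, F ⊆ G → ∃ t : P F ↪[L] P G, K.Strong t ∧
      ∀ α α', t (a F α) = a G α' ↔ W.eq (.inl (F, α)) (.inl (G, α')) := by
    intro F G hFG
    obtain ⟨i, -, hi⟩ := hW (D F ∪ D G) ∅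
      ((mk_union_le _ _).trans (add_le_of_le hω (hD F) (hD G))) (by simp)
    obtain ⟨q, hq, hqa, hqr⟩ := hemb i F _ hi Set.subset_union_left
    obtain ⟨t, ht, hta⟩ := hlift (P F) i G _ hi Set.subset_union_right q hq
      (hqr.subset.trans (hmono i F G hFG))
    refine ⟨t, ht, fun α α' => ?_⟩
    rw [hta, hqa]
    exact heveq hi (Or.inl (hmemD F α)) (Or.inr (hmemD G α'))
  have hsmall : ∀ s : Set C, s.Finite → #s ≤ K.ls := fun s hs => hs.lt_aleph0.le.trans hω
  have hrefl : ∀ c, W.eq c c := by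
    intro c
    obtain ⟨i, -, hi⟩ := hW {c} ∅ (hsmall _ (Set.toFinite _)) (by simp)
    exact (heveq hi rfl rfl).1 rfl
  have hsymm : ∀ c d, W.eq c d → W.eq d c := by
    intro c d hcd
    obtain ⟨i, -, hi⟩ := hW {c, d} ∅ (hsmall _ (Set.toFinite _)) (by simp)
    exact (heveq hi (by simp) (by simp)).1 ((heveq hi (by simp) (by simp)).2 hcd).symm
  have htr : ∀ c d e, W.eq c d → W.eq d e → W.eq c e := by
    intro c d e hcd hde
    obtain ⟨i, -, hi⟩ := hW {c, d, e} ∅ (hsmall _ (Set.toFinite _)) (by simp)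
    exact (heveq hi (by simp) (by simp)).1
      (((heveq hi (by simp) (by simp)).2 hcd).trans ((heveq hi (by simp) (by simp)).2 hde))
  choose t ht hta using htrans
  obtain ⟨Q, g, hQ, hg, hgt, -, -⟩ := K.chain_union (Finset β) inferInstance inferInstance P t
    hPmem ht (fun F G H hFG hGH => by
      ext x
      obtain ⟨α, rfl⟩ := ha F x
      obtain ⟨α', hα'⟩ := ha G (t F G hFG (a F α))
      obtain ⟨γ, hγ⟩ := ha H (t G H hGH (a G α'))
      have h1 := (hta _ _ _ _ _).1 hα'.symm
      have h2 := (hta _ _ _ _ _).1 hγ.symm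
      change t G H hGH (t F G hFG (a F α)) = _
      rw [← hα', ← hγ]
      exact ((hta _ _ _ _ _).2 (htr _ _ _ h1 h2)).symm)
  have hgt' : ∀ F G hFG x, g G (t F G hFG x) = g F x :=
    fun F G hFG x => DFunLike.congr_fun (hgt F G hFG) x
  have hgeq : ∀ F G α α', W.eq (.inl (F, α)) (.inl (G, α')) → g F (a F α) = g G (a G α') := by
    intro F G α α' hW'
    have hF : F ⊆ F ∪ G := Finset.subset_union_left
    have hG : G ⊆ F ∪ G := Finset.subset_union_right
    obtain ⟨γ, hγ⟩ := ha (F ∪ G) (t F _ hF (a F α))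
    have h1 := (hta _ _ _ _ _).1 hγ.symm
    have h2 := (hta G (F ∪ G) hG α' γ).2 (htr _ _ _ (hsymm _ _ hW') h1)
    rw [← hgt' F _ hF, ← hgt' G _ hG, h2, hγ]
  have hbase : ∀ b, ∃ r : X b ↪[L] P {b}, K.Strong r ∧
      ∀ x α, r x = a {b} α ↔ W.eq (.inr (nm b x)) (.inl ({b}, α)) := by
    intro b
    have hnb : #(Set.range (nm b)) ≤ K.ls := mk_range_le.trans (hXcard b)
    obtain ⟨i, hbi, hi⟩ := hW (D {b} ∪ Sum.inr '' Set.range (nm b)) (Set.range (nm b))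
      ((mk_union_le _ _).trans (add_le_of_le hω (hD _) (mk_image_le.trans hnb))) hnb
    obtain ⟨q, hq, hqx⟩ := hh i b hbi
    obtain ⟨r, hr, hrx⟩ := hlift (X b) i {b} _ hi Set.subset_union_left q hq (by
      rintro _ ⟨x, rfl⟩
      rw [hqx]
      exact hcS i {b} b (Finset.mem_singleton_self b) ⟨_, ⟨x, rfl⟩, rfl⟩)
    refine ⟨r, hr, fun x α => ?_⟩
    rw [hrx, hqx]
    exact heveq hi (c := .inr (nm b x)) (Or.inr ⟨_, ⟨x, rfl⟩, rfl⟩) (Or.inl (hmemD _ _))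
  choose r hr hrx using hbase
  have hreq : ∀ b b' x x', W.eq (.inr (nm b x)) (.inr (nm b' x')) →
      g {b} (r b x) = g {b'} (r b' x') := by
    intro b b' x x' hxx
    obtain ⟨α, hα⟩ := ha {b} (r b x)
    obtain ⟨α', hα'⟩ := ha {b'} (r b' x')
    rw [← hα, ← hα']
    exact hgeq _ _ _ _ (htr _ _ _ (hsymm _ _ ((hrx _ _ _).1 hα.symm))
      (htr _ _ _ hxx ((hrx _ _ _).1 hα'.symm)))
  choose b x hbx using hcov
  refine ⟨Q, fun z => g {b z} (r (b z) (x z)), hQ, fun b' => ⟨(g {b'}).comp (r b'),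
    K.strong_comp _ _ (hr _) (hg _), fun x' => hreq _ _ _ _ ?_⟩, fun z z' hzz => hreq _ _ _ _ ?_⟩
  · rw [hbx]
    exact hrefl _
  · rw [hbx, hbx]
    obtain ⟨i, hyi, hi⟩ := hW {.inr z, .inr z'} {z, z'} (hsmall _ (Set.toFinite _))
      ((Set.toFinite _).lt_aleph0.le.trans hω)
    exact (heveq hi (by simp) (by simp)).1 (hzz i (hyi (by simp)) (hyi (by simp)))

end Limits

section Amalgamation

open FirstOrder.Language

variable {L : FirstOrder.Language.{u, u}}

/-- If `M1` and `M2` extend `M0` and small models can be amalgamated, then small parts of `M1` and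
`M2` can be amalgamated over the corresponding part of `M0`. -/
theorem AEC.AP.exists_local_amalgam {K : AEC L} {μ : Cardinal.{u}} (hAP : K.AP (Set.Ico K.ls μ))
    (hμ : K.ls < μ) {M0 M1 M2 : Struct L} {e1 : M0 ↪[L] M1} {e2 : M0 ↪[L] M2}
    (he1 : K.Strong e1) (he2 : K.Strong e2) (hM0 : K.ls ≤ #M0) (A : Set (M1 ⊕ M2)) (hA : #A < μ) :
    ∃ (N : Struct L) (h : M1 ⊕ M2 → N), K.Mem N ∧ Nonempty N ∧
      (∀ (X : Struct L) (u : X ↪[L] M1), K.Strong u → Set.range (fun x => Sum.inl (u x)) ⊆ A →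
        ∃ q : X ↪[L] N, K.Strong q ∧ ∀ x, q x = h (Sum.inl (u x))) ∧
      (∀ (X : Struct L) (u : X ↪[L] M2), K.Strong u → Set.range (fun x => Sum.inr (u x)) ⊆ A →
        ∃ q : X ↪[L] N, K.Strong q ∧ ∀ x, q x = h (Sum.inr (u x))) ∧
      ∀ x, Sum.inl (e1 x) ∈ A → h (Sum.inl (e1 x)) = h (Sum.inr (e2 x)) := by
  have hω := K.aleph0_le_ls
  have hωμ : ℵ₀ ≤ μ := hω.trans hμ.le
  obtain ⟨Z, hZ⟩ := le_mk_iff_exists_set.1 hM0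
  have hA1 : #(Sum.inl ⁻¹' A : Set M1) < μ :=
    (mk_preimage_of_injective _ _ Sum.inl_injective).trans_lt hA
  have hA2 : #(Sum.inr ⁻¹' A : Set M2) < μ :=
    (mk_preimage_of_injective _ _ Sum.inr_injective).trans_lt hA
  have hA0 : #(e1 ⁻¹' (Sum.inl ⁻¹' A) : Set M0) < μ :=
    (mk_preimage_of_injective _ _ e1.injective).trans_lt hA1
  obtain ⟨M0', v0, -, hv0, hZ0, hcard0⟩ :=
    K.loewenheim_skolem M0 (K.strong_dom _ he1).1 (Z ∪ e1 ⁻¹' (Sum.inl ⁻¹' A))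
  have hlt0 : #M0' < μ := hcard0.trans_lt (add_lt_of_lt hωμ
    ((mk_union_le _ _).trans_lt (add_lt_of_lt hωμ (hZ.trans_lt hμ) hA0)) hμ)
  have hle0 : K.ls ≤ #M0' :=
    hZ.symm.le.trans ((mk_le_mk_of_subset (Set.subset_union_left.trans hZ0)).trans mk_range_le)
  have extend : ∀ (M : Struct L) (e : M0 ↪[L] M), K.Strong e → ∀ Y : Set M, #Y < μ →
      ∃ (M' : Struct L) (v : M' ↪[L] M) (e' : M0' ↪[L] M'), K.Strong v ∧ K.Strong e' ∧
        v.comp e' = e.comp v0 ∧ Y ⊆ Set.range v ∧ #M' ∈ Set.Ico K.ls μ := by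
    intro M e he Y hY
    obtain ⟨M', v, -, hv, hsub, hcard⟩ :=
      K.loewenheim_skolem M (K.strong_dom _ he).2 (Y ∪ Set.range (e.comp v0))
    obtain ⟨e', he', hcomp⟩ := K.exists_strong_comp_eq (e.comp v0) v (K.strong_comp _ _ hv0 he) hv
      (Set.subset_union_right.trans hsub)
    exact ⟨M', v, e', hv, he', hcomp, Set.subset_union_left.trans hsub,
      hle0.trans (mk_le_of_injective e'.injective), hcard.trans_lt (add_lt_of_lt hωμ
        ((mk_union_le _ _).trans_lt (add_lt_of_lt hωμ hY (mk_range_le.trans_lt hlt0))) hμ)⟩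
  obtain ⟨M1', v1, e1', hv1, he1', hc1, hY1, hcard1⟩ := extend M1 e1 he1 _ hA1
  obtain ⟨M2', v2, e2', hv2, he2', hc2, hY2, hcard2⟩ := extend M2 e2 he2 _ hA2
  obtain ⟨N, f1, f2, hN, hf1, hf2, hf⟩ := hAP M0' M1' M2' e1' e2' (K.strong_dom _ hv0).1
    (K.strong_dom _ hv1).1 (K.strong_dom _ hv2).1 ⟨hle0, hlt0⟩ hcard1 hcard2 he1' he2'
  obtain ⟨n⟩ : Nonempty M0' := mk_ne_zero_iff.1 (aleph0_pos.trans_le (hω.trans hle0)).ne'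
  have factor : ∀ (M M' : Struct L) (v : M' ↪[L] M) (f : M' ↪[L] N), K.Strong v → K.Strong f →
      ∀ (X : Struct L) (u : X ↪[L] M), K.Strong u → Set.range u ⊆ Set.range v →
        ∃ q : X ↪[L] N, K.Strong q ∧ ∀ x, q x = Function.extend v f (fun _ => f1 (e1' n)) (u x) := by
    intro M M' v f hv hf X u hu hsub
    obtain ⟨j, hj, hvj⟩ := K.exists_strong_comp_eq u v hu hv hsub
    refine ⟨f.comp j, K.strong_comp _ _ hj hf, fun x => ?_⟩
    rw [← hvj]
    exact (v.injective.extend_apply _ _ _).symm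
  refine ⟨N, Sum.elim (Function.extend v1 f1 fun _ => f1 (e1' n))
    (Function.extend v2 f2 fun _ => f1 (e1' n)), hN, ⟨f1 (e1' n)⟩, fun X u hu hsub =>
    factor M1 M1' v1 f1 hv1 hf1 X u hu ?_, fun X u hu hsub =>
    factor M2 M2' v2 f2 hv2 hf2 X u hu ?_, fun x hx => ?_⟩
  · exact Set.Subset.trans (Set.range_subset_iff.2 fun x => hsub ⟨x, rfl⟩) hY1
  · exact Set.Subset.trans (Set.range_subset_iff.2 fun x => hsub ⟨x, rfl⟩) hY2
  · obtain ⟨y, rfl⟩ := hZ0 (Or.inr hx)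
    have h1 : e1 (v0 y) = v1 (e1' y) := (DFunLike.congr_fun hc1 y).symm
    have h2 : e2 (v0 y) = v2 (e2' y) := (DFunLike.congr_fun hc2 y).symm
    rw [Sum.elim_inl, Sum.elim_inr, h1, h2, v1.injective.extend_apply, v2.injective.extend_apply]
    exact DFunLike.congr_fun hf y

/-- The limit property transfers amalgamation from models of size `< μ` to models of
size `≤ θ`. -/
theorem AEC.AP.of_limitProp {K : AEC L} {κ μ θ : Cardinal.{u}} (hAP : K.AP (Set.Ico K.ls μ))
    (hκ : K.ls < κ) (hμ : K.ls < μ)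
    (hlim : ∀ B : Type u, #B ≤ θ →
      ∃ (I : Type u) (A : I → Set B), (∀ i, #(A i) < μ) ∧ LimitProp κ θ A) :
    K.AP (Set.Icc K.ls θ) := by
  intro M0 M1 M2 e1 e2 hM0 hM1 hM2 hc0 hc1 hc2 he1 he2
  have hω := K.aleph0_le_ls
  have hlsθ : K.ls ≤ θ := hc0.1.trans hc0.2
  have hB : #(M1 ⊕ M2) ≤ θ := by
    rw [mk_sum, lift_id, lift_id]
    exact add_le_of_le (hω.trans hlsθ) hc1.2 hc2.2
  obtain ⟨I, A, hAμ, hA⟩ := hlim (M1 ⊕ M2) hB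
  choose N h hN hne hl hr heq using
    fun i => hAP.exists_local_amalgam hμ he1 he2 hc0.1 (A i) (hAμ i)
  have hinf : ∀ M : Struct L, K.ls ≤ #M → Infinite M := fun M hM => infinite_iff.2 (hω.trans hM)
  have hinf1 := hinf M1 hc1.1
  have hinf2 := hinf M2 hc2.1
  have hsingle : ∀ (M : Struct L) (m : M), #({m} : Set M) ≤ K.ls := fun M m => by
    rw [mk_singleton]
    exact one_le_aleph0.trans hω
  obtain ⟨X1, u1, hu1, hX1, -, hmono1, hcov1⟩ :=
    K.exists_finset_system hM1 (fun m => {m}) (hsingle M1)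
  obtain ⟨X2, u2, hu2, hX2, -, hmono2, hcov2⟩ :=
    K.exists_finset_system hM2 (fun m => {m}) (hsingle M2)
  have hmem1 : ∀ m, ∃ F, m ∈ Set.range (u1 F) :=
    fun m => ⟨{m}, hcov1 {m} m (Finset.mem_singleton_self m) rfl⟩
  have hmem2 : ∀ m, ∃ F, m ∈ Set.range (u2 F) :=
    fun m => ⟨{m}, hcov2 {m} m (Finset.mem_singleton_self m) rfl⟩
  let X : Finset M1 ⊕ Finset M2 → Struct L := Sum.elim X1 X2
  let nm : ∀ b, X b → M1 ⊕ M2 := fun b => match b with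
    | .inl F => fun x => .inl (u1 F x)
    | .inr F => fun x => .inr (u2 F x)
  obtain ⟨P, ρ, hP, hρ, hρeq⟩ := K.exists_limit_model hκ hlsθ hA hB
    (β := Finset M1 ⊕ Finset M2) (by
      rw [mk_sum, lift_id, lift_id, mk_finset_of_infinite, mk_finset_of_infinite]
      exact add_le_of_le (hω.trans hlsθ) hc1.2 hc2.2) X
    (by
      rintro (F | F)
      exacts [hX1 F, hX2 F]) nm
    (by
      rintro (m | m)
      · obtain ⟨F, x, rfl⟩ := hmem1 m
        exact ⟨.inl F, x, rfl⟩
      · obtain ⟨F, x, rfl⟩ := hmem2 m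
        exact ⟨.inr F, x, rfl⟩) N hN hne h
    (by
      rintro i (F | F) hF
      exacts [hl i _ (u1 F) (hu1 F) hF, hr i _ (u2 F) (hu2 F) hF])
  obtain ⟨f1, hf1, hf1ρ⟩ := K.exists_strong_of_directed hM1 hP X1 u1 hu1 hmono1 hmem1
    (fun m => ρ (.inl m)) fun F => hρ (.inl F)
  obtain ⟨f2, hf2, hf2ρ⟩ := K.exists_strong_of_directed hM2 hP X2 u2 hu2 hmono2 hmem2
    (fun m => ρ (.inr m)) fun F => hρ (.inr F)
  refine ⟨P, f1, f2, hP, hf1, hf2, ?_⟩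
  ext x
  change f1 (e1 x) = f2 (e2 x)
  rw [hf1ρ, hf2ρ]
  exact hρeq _ _ fun i hi _ => heq i x hi

end Amalgamation

section LargeCardinals

theorem FilterComplete.eventually_all {α : Type u} {F : Filter α} {κ : Cardinal.{u}}
    (hF : FilterComplete F κ) {J : Type u} {s : Set J} (hs : #s < κ) {p : J → α → Prop}
    (hp : ∀ j ∈ s, ∀ᶠ a in F, p j a) : ∀ᶠ a in F, ∀ j ∈ s, p j a := by
  filter_upwards [hF ((fun j => {a | p j a}) '' s) (mk_image_le.trans_lt hs)
    (Set.forall_mem_image.2 hp)] with a ha j hj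
  exact ha _ ⟨j, hj, rfl⟩

/-- Ultrafilter limits witness the limit property. -/
theorem LimitProp.of_ultrafilter {κ θ : Cardinal.{u}} {I B : Type u} {A : I → Set B}
    (U : Ultrafilter I) (hU : FilterComplete (U : Filter I) κ)
    (hA : ∀ b, ∀ᶠ i in (U : Filter I), b ∈ A i) : LimitProp κ θ A := by
  intro J _ v
  refine ⟨fun j => ∀ᶠ i in (U : Filter I), v i j, fun s y hs hy => ?_⟩
  have hv : ∀ j, ∀ᶠ i in (U : Filter I), v i j ↔ ∀ᶠ i in (U : Filter I), v i j := by
    intro j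
    by_cases hj : ∀ᶠ i in (U : Filter I), v i j
    · filter_upwards [hj] with i hi
      exact iff_of_true hi hj
    · filter_upwards [Ultrafilter.eventually_not.2 hj] with i hi
      exact iff_of_false hi hj
  exact ((hU.eventually_all hy fun b _ => hA b).and (hU.eventually_all hs fun j _ => hv j)).exists

theorem IsLamStronglyCompact.exists_limitProp {κ lam : Cardinal.{u}}
    (h : IsLamStronglyCompact κ lam) {B : Type u} (hB : #B ≤ lam) :
    ∃ (I : Type u) (A : I → Set B), (∀ i, #(A i) < κ) ∧ LimitProp κ lam A := by
  obtain ⟨U, hU, hfine⟩ := h lam.out (mk_out _)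
  obtain ⟨f⟩ : Nonempty (B ↪ lam.out) := by rwa [← le_def, mk_out]
  exact ⟨{s : Set lam.out // #s < κ}, fun s => f ⁻¹' s.1,
    fun s => (mk_preimage_of_injective _ _ f.injective).trans_lt s.2,
    .of_ultrafilter U hU fun b => hfine (f b)⟩

theorem FilterComplete.compl_mem_of_mk_lt {α : Type u} {U : Ultrafilter α} {κ : Cardinal.{u}}
    (hU : FilterComplete (U : Filter α) κ) (hne : ∀ a, U ≠ pure a) {s : Set α} (hs : #s < κ) :
    sᶜ ∈ (U : Filter α) := by
  have := hU.eventually_all hs (p := fun a b => b ≠ a) fun a _ => by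
    refine Ultrafilter.eventually_not.2 fun ha => ?_
    obtain ⟨b, -, hb⟩ := Ultrafilter.eq_pure_of_finite_mem (Set.finite_singleton a) ha
    exact hne b hb
  filter_upwards [this] with b hb hbs
  exact hb b hbs rfl

theorem IsMeasurableCard.exists_limitProp {κ lam : Cardinal.{u}} (h : IsMeasurableCard κ)
    (hκ : ℵ₀ ≤ κ) (hcof : lam.ord.cof = κ) {B : Type u} (hB : #B ≤ lam) :
    ∃ (I : Type u) (A : I → Set B), (∀ i, #(A i) < lam) ∧ LimitProp κ lam A := by
  obtain ⟨α, U, hα, hU, hne⟩ := h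
  have hcof' : Order.cof lam.ord.ToType = κ := by rw [Ordinal.cof_toType, hcof]
  obtain ⟨S, hS, hScard⟩ := Order.exists_cof_eq lam.ord.ToType
  rw [hcof'] at hScard
  obtain ⟨e⟩ : Nonempty (α ≃ κ.ord.ToType) := Cardinal.eq.1 (by rw [hα, mk_ord_toType])
  obtain ⟨c⟩ : Nonempty (α ≃ S) := Cardinal.eq.1 (by rw [hα, hScard])
  obtain ⟨f⟩ : Nonempty (B ↪ lam.ord.ToType) := by rwa [← le_def, mk_ord_toType]
  have := noMaxOrder hκ
  refine ⟨α, fun i => {b | ∃ j, e j < e i ∧ f b ≤ c j}, fun i => ?_, .of_ultrafilter U hU ?_⟩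
  · have hlt : #((fun j => (c j : lam.ord.ToType)) '' {j | e j < e i}) < κ := by
      refine mk_image_le.trans_lt ?_
      refine (mk_preimage_of_injective (s := Set.Iio (e i)) _ e.injective).trans_lt ?_
      have := mk_Iio_lt (e i) (by simp)
      simpa using this
    have hnot : ¬ IsCofinal ((fun j => (c j : lam.ord.ToType)) '' {j | e j < e i}) := by
      intro hc
      exact (hcof'.symm.le.trans (Order.cof_le hc)).not_gt hlt
    obtain ⟨x, hx⟩ := not_isCofinal_iff.1 hnot
    refine (mk_le_mk_of_subset (t := f ⁻¹' Set.Iio x) ?_).trans_lt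
      ((mk_preimage_of_injective _ _ f.injective).trans_lt ?_)
    · rintro b ⟨j, hj, hb⟩
      exact hb.trans_lt (hx _ ⟨j, hj, rfl⟩)
    · have := mk_Iio_lt x (by simp)
      simpa using this
  · intro b
    obtain ⟨y, hy, hby⟩ := hS (f b)
    have hsmall : #{i | e i ≤ e (c.symm ⟨y, hy⟩)} < κ := by
      obtain ⟨z, hz⟩ := exists_gt (e (c.symm ⟨y, hy⟩))
      refine (mk_le_mk_of_subset (t := e ⁻¹' Set.Iio z) fun i hi => lt_of_le_of_lt hi hz).trans_lt
        ((mk_preimage_of_injective _ _ e.injective).trans_lt ?_)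
      have := mk_Iio_lt z (by simp)
      simpa using this
    filter_upwards [hU.compl_mem_of_mk_lt hne hsmall] with i hi
    exact ⟨c.symm ⟨y, hy⟩, not_le.1 hi, by simpa using hby⟩

theorem mk_subset_mk_lt_le {κ : Cardinal.{u}} (hκ : κ.IsInaccessible) {B : Type u} (hB : #B ≤ κ) :
    #{s : Set B // #s < κ} ≤ κ := by
  obtain ⟨f⟩ : Nonempty (B ↪ κ.out) := by rwa [← le_def, mk_out]
  have hcard : #{s : Set κ.out // #s < κ} = κ := by
    have := mk_subset_mk_lt_cof (α := κ.out) (by rw [mk_out]; exact hκ.isStrongPrelimit)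
    rwa [mk_out, hκ.isRegular.cof_ord] at this
  refine (mk_le_of_injective (f := fun s : {s : Set B // #s < κ} =>
    (⟨f '' s.1, mk_image_le.trans_lt s.2⟩ : {s : Set κ.out // #s < κ})) ?_).trans hcard.le
  intro s t hst
  exact Subtype.ext (f.injective.image_injective (Subtype.ext_iff.1 hst))

/-- The purely relational language with a propositional variable for every element of `J`. -/
def propLanguage (J : Type u) : FirstOrder.Language.{u, u} where
  Functions _ := PEmpty
  Relations _ := J

/-- The propositional variable `j` as a nullary relation symbol. -/
def propSymbol {J : Type u} (j : J) : (propLanguage J).Relations 0 := j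

/-- The propositional variable `j` as a sentence. -/
def propVar {J : Type u} (κ : Cardinal.{u}) (j : J) : LKK (propLanguage J) κ PEmpty.{u + 1} :=
  .of ((propSymbol j).formula Fin.elim0)

open Classical in
/-- The sentence asserting that the propositional variables in `s` are valued according to some
member of the family `H`. -/
noncomputable def valuationSentence {J : Type u} {κ : Cardinal.{u}} (s : {s : Set J // #s < κ})
    (H : {H : Set (Set s.1) // #H < κ}) : LKK (propLanguage J) κ PEmpty.{u + 1} :=
  .not (.conj H.1 H.2 fun h => .not (.conj s.1 s.2 fun j =>
    if j ∈ h.1 then propVar κ j.1 else .not (propVar κ j.1)))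

theorem realize_propVar {J : Type u} {κ : Cardinal.{u}} {M : Type u} [(propLanguage J).Structure M]
    (j : J) (x : PEmpty.{u + 1} → M) : (propVar κ j).Realize x ↔
      FirstOrder.Language.Structure.RelMap (propSymbol j) (Fin.elim0 : Fin 0 → M) := by
  rw [propVar, LKK.Realize, FirstOrder.Language.Formula.realize_rel]
  exact iff_of_eq (congrArg _ (Subsingleton.elim _ _))

theorem realize_valuationSentence {J : Type u} {κ : Cardinal.{u}} {M : Type u}
    [(propLanguage J).Structure M] (s : {s : Set J // #s < κ}) (H : {H : Set (Set s.1) // #H < κ})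
    (x : PEmpty.{u + 1} → M) : (valuationSentence s H).Realize x ↔
      ∃ h ∈ H.1, ∀ j : s.1, j ∈ h ↔ (propVar κ j.1).Realize x := by
  simp only [valuationSentence, LKK.Realize]
  rw [not_forall]
  simp only [not_not]
  refine Iff.trans (exists_congr fun h => forall_congr' fun j => ?_)
    ⟨fun ⟨h, hh⟩ => ⟨h.1, h.2, hh⟩, fun ⟨h, hH, hh⟩ => ⟨⟨h, hH⟩, hh⟩⟩
  split_ifs with hj
  · exact (iff_true_left hj).symm
  · exact (iff_false_left hj).symm

theorem IsWeaklyCompactCard.limitProp {κ : Cardinal.{u}} (hκ : IsWeaklyCompactCard κ) {B : Type u}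
    (hB : #B ≤ κ) : LimitProp κ κ fun t : {t : Set B // #t < κ} => t.1 := by
  obtain ⟨hin, hcomp⟩ := hκ
  have hω : ℵ₀ ≤ κ := hin.isRegular.aleph0_le
  intro J hJ v
  let H : ∀ p : {s : Set J // #s < κ} × {y : Set B // #y < κ}, {H : Set (Set p.1.1) // #H < κ} :=
    fun p => ⟨{h | ∃ t : {t : Set B // #t < κ}, p.2.1 ⊆ t.1 ∧ ∀ j : p.1.1, j ∈ h ↔ v t j},
      (mk_set_le _).trans_lt (by
        rw [mk_set]
        exact hin.isStrongPrelimit p.1.2)⟩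
  let φ : {s : Set J // #s < κ} × {y : Set B // #y < κ} →
    LKK (propLanguage J) κ PEmpty.{u + 1} := fun p => valuationSentence p.1 (H p)
  obtain ⟨M, -, hM⟩ := hcomp (propLanguage J) (Set.range φ) (by
      have := mk_range_le_lift (f := φ)
      rw [lift_id'.{u, u + 1}] at this
      refine this.trans (lift_le.2 ?_)
      rw [mk_prod, lift_id, lift_id]
      exact (mul_le_mul' (mk_subset_mk_lt_le hin hJ) (mk_subset_mk_lt_le hin hB)).trans
        (mul_eq_self hω).le) (by
      intro Φ₀ hΦ hcard
      obtain ⟨c, hc, hcΦ⟩ := lt_lift_iff.1 hcard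
      obtain ⟨e⟩ : Nonempty (c.out ≃ Φ₀) := by
        rw [← lift_mk_eq'.{u, u + 1}, mk_out, hcΦ, lift_id'.{u, u + 1}]
      choose p hp using fun k : c.out => hΦ (e k).2
      let t : {t : Set B // #t < κ} := ⟨⋃ k, (p k).2.1,
        (card_iUnion_lt_iff_forall_of_isRegular hin.isRegular (by rwa [mk_out])).2
          fun k => (p k).2.2⟩
      let str : (propLanguage J).Structure PUnit.{u + 1} :=
        { funMap := fun F => F.elim
          RelMap := fun j _ => v t j }
      refine ⟨⟨PUnit.{u + 1}, str⟩, ⟨PUnit.unit⟩, fun ψ hψ => ?_⟩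
      obtain ⟨k, hk⟩ := e.surjective ⟨ψ, hψ⟩
      have hψk : φ (p k) = ψ := by rw [hp, hk]
      rw [← hψk]
      refine (realize_valuationSentence _ _ _).2 ⟨{j | v t j},
        ⟨t, Set.subset_iUnion (fun k => (p k).2.1) k, fun j => Iff.rfl⟩, fun j => ?_⟩
      rw [realize_propVar]
      rfl)
  refine ⟨fun j => (propVar κ j).Realize (M := M) fun x => x.elim, fun s y hs hy => ?_⟩
  obtain ⟨h, ⟨t, hyt, ht⟩, hh⟩ :=
    (realize_valuationSentence _ _ _).1 (hM _ ⟨(⟨s, hs⟩, ⟨y, hy⟩), rfl⟩)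
  exact ⟨t, hyt, fun j hj => (ht ⟨j, hj⟩).symm.trans (hh ⟨j, hj⟩)⟩

end LargeCardinals

/-- **Corollary 3.22**: suppose `K` is an AEC with `LS(K) < κ`.  Then:
(a) if `κ` is weakly compact and `K` has AP on `[LS(K), κ)`, then `K` has AP on `[LS(K), κ]`;
(b) if `κ` is measurable, `cf(λ) = κ`, and `K` has AP on `[LS(K), λ)`, then `K` has AP on
    `[LS(K), λ]`;
(c) if `κ` is `λ`-strongly compact and `K` has AP on `[LS(K), κ)`, then `K` has AP on
    `[LS(K), λ]`. -/
theorem ap_extension_of_largeCardinals (L : FirstOrder.Language.{u, u}) (K : AEC L)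
    (κ : Cardinal.{u}) (hls : K.ls < κ) :
    (IsWeaklyCompactCard κ → K.AP (Set.Ico K.ls κ) → K.AP (Set.Icc K.ls κ)) ∧
    (∀ lam : Cardinal.{u}, IsMeasurableCard κ → lam.ord.cof = κ →
      K.AP (Set.Ico K.ls lam) → K.AP (Set.Icc K.ls lam)) ∧
    (∀ lam : Cardinal.{u}, IsLamStronglyCompact κ lam →
      K.AP (Set.Ico K.ls κ) → K.AP (Set.Icc K.ls lam)) := by
  have hω : ℵ₀ ≤ κ := K.aleph0_le_ls.trans hls.le
  refine ⟨fun h hAP => hAP.of_limitProp hls hls fun B hB => ⟨_, _, fun t => t.2, h.limitProp hB⟩,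
    fun lam h hcof hAP => ?_, fun lam h hAP => hAP.of_limitProp hls hls fun B hB =>
      h.exists_limitProp hB⟩
  have hlam : κ ≤ lam := hcof ▸ Ordinal.cof_ord_le lam
  exact hAP.of_limitProp hls (hls.trans_le hlam) fun B hB => h.exists_limitProp hω hcof hB

end Paper
end
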